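/- arXiv:1709.06268 — 2 statements merged into one kernel-verified Lean document; each statement's English description precedes it below -/
import Mathlib

section
/- Let 0 < λ ≤ 2, ν > 0 and ν + λ > 1. Then for every θ ∈ [0,π), | (sin θ)^{λ+1} · ʳG_ν^{(λ)}(cos θ) − (2^λ Γ(λ+1/2))/(√π (ν+λ)^λ) · (sin θ) · cos((ν+λ)θ − λπ/2) | ≤ (sin θ) · (λ |λ−1| 2^λ Γ(λ+1/2))/(√π (ν+λ−1)^{λ+1}) · ( |cot θ| + (2/3)·(λ+1)/(ν+λ−1) ), where at θ = 0 the right-hand side is interpreted as the limit (sin θ)·|cot θ| → |cos θ| = 1, i.e. both sides are finite (the left-hand side equals 0 at θ = 0). -/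
open Real

/-- Pochhammer symbol `(a)_n = a (a+1) ⋯ (a+n-1)` for a real base. -/
noncomputable def poch (a : ℝ) (n : ℕ) : ℝ := ∏ i ∈ Finset.range n, (a + (i : ℝ))

/-- The right generalized Gegenbauer function of fractional degree. -/
noncomputable def rG (lam nu x : ℝ) : ℝ :=
  ∑' j : ℕ, (poch (-nu) j * poch (nu + 2 * lam) j /
    ((j.factorial : ℝ) * poch (lam + 1 / 2) j)) * ((1 - x) / 2) ^ j

/-- Coefficients with unit radius of (absolute) convergence. -/
def Good (a : ℕ → ℝ) : Prop := ∀ r : ℝ, 0 < r → r < 1 → Summable (fun n => |a n| * r ^ n)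

/-- Formal derivative. -/
def fD (a : ℕ → ℝ) : ℕ → ℝ := fun n => ((n : ℝ) + 1) * a (n + 1)

/-- Power series sum. -/
noncomputable def pS (a : ℕ → ℝ) (x : ℝ) : ℝ := ∑' n, a n * x ^ n

/-- Hypergeometric coefficients. -/
noncomputable def hc (a b c : ℝ) (n : ℕ) : ℝ :=
  poch a n * poch b n / ((n.factorial : ℝ) * poch c n)

lemma Good.summable {a : ℕ → ℝ} (h : Good a) {x : ℝ} (hx : |x| < 1) :
    Summable (fun n => a n * x ^ n) := by
  obtain ⟨r, hr1, hr2⟩ := exists_between hx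
  have hr0 : 0 < r := lt_of_le_of_lt (abs_nonneg x) hr1
  refine Summable.of_norm_bounded (h r hr0 hr2) ?_
  intro n
  rw [norm_mul, norm_pow, Real.norm_eq_abs, Real.norm_eq_abs]
  gcongr

lemma Good.hasSum {a : ℕ → ℝ} (h : Good a) {x : ℝ} (hx : |x| < 1) :
    HasSum (fun n => a n * x ^ n) (pS a x) := (h.summable hx).hasSum

lemma Good.fD {a : ℕ → ℝ} (h : Good a) : Good (fD a) := by
  intro r hr0 hr1
  obtain ⟨q, hq1, hq2⟩ := exists_between hr1
  have hq0 : 0 < q := hr0.trans hq1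
  have hs := h q hq0 hq2
  have hs' : Summable (fun n => |a (n+1)| * q ^ (n+1)) := (summable_nat_add_iff 1).2 hs
  have hbd : ∃ C, ∀ n : ℕ, ((n : ℝ) + 1) * (r / q) ^ n ≤ C := by
    have hlt : r / q < 1 := (div_lt_one hq0).2 hq1
    have h0 : 0 ≤ r / q := by positivity
    have h1 := tendsto_self_mul_const_pow_of_lt_one h0 hlt
    have h2 := tendsto_pow_atTop_nhds_zero_of_lt_one h0 hlt
    have h3 := (h1.add h2).bddAbove_range
    obtain ⟨C, hC⟩ := h3
    refine ⟨C, fun n => ?_⟩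
    have := hC ⟨n, rfl⟩
    simp only at this
    linarith
  obtain ⟨C, hC⟩ := hbd
  refine Summable.of_norm_bounded (hs'.mul_left (C / q)) ?_
  intro n
  have e : ‖|_root_.fD a n| * r ^ n‖ = (((n : ℝ) + 1) * (r / q) ^ n) * (|a (n+1)| * q ^ n) := by
    rw [norm_mul, norm_pow, Real.norm_eq_abs, Real.norm_eq_abs, abs_abs, abs_of_pos hr0]
    unfold _root_.fD
    rw [abs_mul, abs_of_nonneg (by positivity : (0:ℝ) ≤ (n:ℝ) + 1), div_pow]
    field_simp
  rw [e]
  have : C / q * (|a (n + 1)| * q ^ (n + 1)) = C * (|a (n+1)| * q ^ n) := by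
    rw [pow_succ]; field_simp
  rw [this]
  exact mul_le_mul_of_nonneg_right (hC n) (by positivity)

lemma Good.hasFPS {a : ℕ → ℝ} (h : Good a) :
    HasFPowerSeriesOnBall (pS a) (FormalMultilinearSeries.ofScalars ℝ a) 0 1 := by
  refine ⟨?_, by norm_num, ?_⟩
  · refine le_of_forall_lt ?_
    intro c hc
    lift c to NNReal using ne_top_of_lt hc
    have hc' : (c : ℝ) < 1 := by exact_mod_cast hc
    obtain ⟨q, hq1, hq2⟩ := exists_between hc'
    have hq0 : 0 < q := lt_of_le_of_lt c.2 hq1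
    lift q to NNReal using hq0.le
    have := (FormalMultilinearSeries.ofScalars ℝ a).le_radius_of_summable (r := q) (by
      have := h q hq0 hq2
      refine this.congr ?_
      intro n
      simp)
    refine lt_of_lt_of_le ?_ this
    exact_mod_cast hq1
  · intro y hy
    have hy' : |y| < 1 := by
      have h1 : ‖y‖ₑ < 1 := by simpa using hy
      rw [← ofReal_norm, Real.norm_eq_abs, ← ENNReal.ofReal_one] at h1
      exact (ENNReal.ofReal_lt_ofReal_iff one_pos).1 h1
    have := h.hasSum hy'
    simpa [FormalMultilinearSeries.ofScalars_apply_eq, mul_comm] using this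

lemma Good.analytic {a : ℕ → ℝ} (h : Good a) : AnalyticOnNhd ℝ (pS a) (Set.Ioo (-1) 1) := by
  have := h.hasFPS.analyticOnNhd
  intro x hx
  refine this x ?_
  simp only [Metric.mem_eball, edist_zero_right]
  rw [← ofReal_norm, Real.norm_eq_abs]
  rw [← ENNReal.ofReal_one]
  exact (ENNReal.ofReal_lt_ofReal_iff one_pos).2 (abs_lt.2 hx)

lemma Good.hasDerivAt {a : ℕ → ℝ} (h : Good a) {x : ℝ} (hx : |x| < 1) :
    HasDerivAt (pS a) (pS (_root_.fD a) x) x := by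
  obtain ⟨r, hr1, hr2⟩ := exists_between hx
  have hr0 : 0 < r := lt_of_le_of_lt (abs_nonneg x) hr1
  have key := hasDerivAt_tsum_of_isPreconnected (𝕜 := ℝ) (α := ℕ) (F := ℝ)
    (u := fun n => |(n : ℝ) * a n| * r ^ (n-1))
    (g := fun n y => a n * y ^ n) (g' := fun n y => a n * (n * y ^ (n-1)))
    (t := Set.Ioo (-r) r) (y₀ := 0) (y := x) ?_ isOpen_Ioo isPreconnected_Ioo ?_ ?_ ?_ ?_ ?_
  · have e : ∑' n, a n * (n * x ^ (n-1)) = pS (_root_.fD a) x := by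
      rw [tsum_eq_zero_add']
      · simp only [pS, _root_.fD]
        simp
        refine tsum_congr fun n => ?_
        ring
      · refine (h.fD.summable hx).congr ?_
        intro n
        simp [_root_.fD]
        ring
    rw [← e]
    exact key
  · have := h.fD r hr0 hr2
    refine (summable_nat_add_iff 1).1 ?_
    refine this.congr ?_
    intro n
    simp [_root_.fD]
  · intro n y _
    exact (hasDerivAt_pow n y).const_mul _
  · intro n y hy
    have : |y| ≤ r := (abs_lt.2 hy).le
    rw [norm_mul, norm_mul, norm_pow, Real.norm_eq_abs, Real.norm_eq_abs, Real.norm_eq_abs, abs_mul]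
    calc |a n| * (|(n:ℝ)| * |y| ^ (n-1)) = |(n:ℝ)| * |a n| * |y| ^ (n-1) := by ring
      _ ≤ _ := by gcongr
  · exact ⟨by linarith, hr0⟩
  · refine h.summable (by simp)
  · exact abs_lt.1 hr1

lemma poch_succ (a : ℝ) (n : ℕ) : poch a (n+1) = poch a n * (a + n) := by
  simp [poch, Finset.prod_range_succ]

lemma poch_zero (a : ℝ) : poch a 0 = 1 := by simp [poch]

lemma poch_pos {a : ℝ} (ha : 0 < a) (n : ℕ) : 0 < poch a n :=
  Finset.prod_pos fun i _ => by positivity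

lemma hc_zero (a b c : ℝ) : hc a b c 0 = 1 := by simp [hc, poch_zero]

lemma hc_succ (a b : ℝ) {c : ℝ} (hc0 : 0 < c) (n : ℕ) :
    hc a b c (n+1) * (((n:ℝ)+1) * (c + n)) = hc a b c n * ((a + n) * (b + n)) := by
  unfold hc
  rw [poch_succ, poch_succ, poch_succ, Nat.factorial_succ]
  have := (poch_pos hc0 n).ne'
  have h2 : c + n ≠ 0 := by positivity
  have h3 : (n.factorial : ℝ) ≠ 0 := by positivity
  push_cast
  field_simp

lemma hc_good (a b : ℝ) {c : ℝ} (hc0 : 0 < c) : Good (hc a b c) := by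
  intro r hr0 hr1
  obtain ⟨q, hq1, hq2⟩ := exists_between hr1
  have hlim : Filter.Tendsto (fun n : ℕ => |((a + n) * (b + n)) / (((n:ℝ)+1) * (c + n))| * r)
      Filter.atTop (nhds (|(1:ℝ) * 1| * r)) := by
    have h1 : ∀ a c : ℝ, 0 < c → Filter.Tendsto (fun n : ℕ => (a + n) / (c + n))
        Filter.atTop (nhds (1:ℝ)) := by
      intro a c hc
      have h2 : Filter.Tendsto (fun n : ℕ => 1 + (a - c) / (c + n)) Filter.atTop
          (nhds ((1:ℝ) + 0)) := by
        refine tendsto_const_nhds.add ?_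
        refine Filter.Tendsto.div_atTop tendsto_const_nhds ?_
        exact Filter.tendsto_atTop_add_const_left _ _ tendsto_natCast_atTop_atTop
      rw [add_zero] at h2
      refine h2.congr ?_
      intro n
      have : c + n ≠ 0 := by positivity
      field_simp
      ring
    have := (((h1 a 1 one_pos).mul (h1 b c hc0)).abs).mul_const r
    refine this.congr ?_
    intro n
    rw [div_mul_div_comm, add_comm (1:ℝ)]
  have hev := hlim.eventually (gt_mem_nhds (show |(1:ℝ) * 1| * r < q by simpa using hq1))
  refine summable_of_ratio_norm_eventually_le (r := q) hq2 ?_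
  filter_upwards [hev] with n hn
  have h1 : 0 < ((n:ℝ)+1) * (c + n) := by positivity
  have h2 : hc a b c (n+1) = hc a b c n * (((a + n) * (b + n)) / (((n:ℝ)+1) * (c + n))) := by
    rw [mul_div, eq_div_iff h1.ne', hc_succ a b hc0]
  rw [h2, norm_mul, norm_mul, norm_pow, norm_pow, Real.norm_eq_abs, Real.norm_eq_abs,
    Real.norm_eq_abs, abs_abs, abs_abs, abs_mul, abs_of_pos hr0, pow_succ]
  have : 0 ≤ |hc a b c n| * r ^ n := by positivity
  nlinarith [mul_le_mul_of_nonneg_right hn.le this]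

lemma pS_zero (a : ℕ → ℝ) : pS a 0 = a 0 := by
  unfold pS
  rw [tsum_eq_single 0]
  · simp
  · intro n hn
    simp [hn]

lemma mulX {a : ℕ → ℝ} (h : Good a) {x : ℝ} (hx : |x| < 1) :
    HasSum (fun n : ℕ => ((n:ℝ) * a n) * x ^ n) (x * pS (fD a) x) := by
  have := (h.fD.hasSum hx).mul_left x
  rw [← hasSum_nat_add_iff' 1]
  simp only [Finset.range_one, Finset.sum_singleton, Nat.cast_zero, zero_mul, sub_zero]
  refine this.congr_fun ?_
  intro n
  simp only [fD]
  push_cast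
  ring

lemma ode (a b : ℝ) {c : ℝ} (hc0 : 0 < c) {x : ℝ} (hx : |x| < 1) :
    x * (1 - x) * pS (fD (fD (hc a b c))) x + (c - (a + b + 1) * x) * pS (fD (hc a b c)) x
      - a * b * pS (hc a b c) x = 0 := by
  have g := hc_good a b hc0
  have s0 := g.hasSum hx
  have s1 := g.fD.hasSum hx
  have s2 := mulX g hx
  have s3 := mulX g.fD hx
  have s4 : HasSum (fun n : ℕ => ((n:ℝ) * (n - 1) * hc a b c n) * x ^ n)
      (x * (x * pS (fD (fD (hc a b c))) x)) := by
    rw [← hasSum_nat_add_iff' 1]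
    simp only [Finset.range_one, Finset.sum_singleton, Nat.cast_zero, zero_mul, sub_zero]
    refine (s3.mul_left x).congr_fun ?_
    intro n
    simp only [fD]
    push_cast
    ring
  have tot := (((s3.sub s4).add (s1.mul_left c)).sub (s2.mul_left (a + b + 1))).sub
    (s0.mul_left (a * b))
  have z : HasSum (fun _ : ℕ => (0:ℝ)) 0 := hasSum_zero
  have e := tot.unique (z.congr_fun ?_)
  · linear_combination e
  · intro n
    simp only [fD]
    linear_combination (x ^ n) * hc_succ a b hc0 n
lemma euler_transform (lam nu : ℝ) (hlam : 0 < lam) {x : ℝ} (hx0 : 0 ≤ x) (hx1 : x < 1) :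
    (1 - x) ^ (lam - 1/2) * pS (hc (-nu) (nu + 2 * lam) (lam + 1/2)) x =
      pS (hc (1/2 + (nu + lam)) (1/2 - (nu + lam)) (lam + 1/2)) x := by
  have hc0 : 0 < lam + 1/2 := by positivity
  have gA := hc_good (-nu) (nu + 2 * lam) hc0
  have gB := hc_good (1/2 + (nu + lam)) (1/2 - (nu + lam)) hc0
  have oA := fun {x : ℝ} (hx : |x| < 1) => ode (-nu) (nu + 2 * lam) hc0 hx
  have oB := fun {x : ℝ} (hx : |x| < 1) => ode (1/2 + (nu + lam)) (1/2 - (nu + lam)) hc0 hx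
  have zA := hc_zero (-nu) (nu + 2 * lam) (lam + 1/2)
  have zB := hc_zero (1/2 + (nu + lam)) (1/2 - (nu + lam)) (lam + 1/2)
  generalize hc (-nu) (nu + 2 * lam) (lam + 1/2) = A at *
  generalize hc (1/2 + (nu + lam)) (1/2 - (nu + lam)) (lam + 1/2) = B at *
  set V : ℝ → ℝ := fun x => (1 - x) * (pS (fD A) x * pS B x - pS A x * pS (fD B) x)
      - (lam - 1/2) * (pS A x * pS B x) with hV
  have dV : ∀ x : ℝ, |x| < 1 → HasDerivAt V
      ((-1) * (pS (fD A) x * pS B x - pS A x * pS (fD B) x) +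
        (1 - x) * ((pS (fD (fD A)) x * pS B x + pS (fD A) x * pS (fD B) x)
          - (pS (fD A) x * pS (fD B) x + pS A x * pS (fD (fD B)) x))
        - (lam - 1/2) * (pS (fD A) x * pS B x + pS A x * pS (fD B) x)) x := by
    intro x hx
    have hA := gA.hasDerivAt hx
    have hB := gB.hasDerivAt hx
    have hA' := gA.fD.hasDerivAt hx
    have hB' := gB.fD.hasDerivAt hx
    exact (((hasDerivAt_id x).const_sub 1).mul ((hA'.mul hB).sub (hA.mul hB'))).sub
      ((hA.mul hB).const_mul _)
  have hV0 : ∀ x : ℝ, 0 < x → x < 1 → V x = 0 := by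
    intro x hx0 hx1
    have hcont : ContinuousOn (fun y : ℝ => y ^ (lam + 1/2) * V y) (Set.Icc 0 x) := by
      intro y hy
      refine ContinuousAt.continuousWithinAt ?_
      refine ContinuousAt.mul ?_ ?_
      · exact Real.continuousAt_rpow_const _ _ (Or.inr hc0.le)
      · exact (dV y (abs_lt.2 ⟨by linarith [hy.1], by linarith [hy.2]⟩)).continuousAt
    obtain ⟨z, hz, hz'⟩ := exists_hasDerivAt_eq_slope (fun y : ℝ => y ^ (lam + 1/2) * V y)
      (fun _ => 0) hx0 hcont (by
        intro y hy
        have hy1 : |y| < 1 := abs_lt.2 ⟨by linarith [hy.1], by linarith [hy.2]⟩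
        have h := (Real.hasDerivAt_rpow_const (x := y) (p := lam + 1/2) (Or.inl hy.1.ne')).mul
          (dV y hy1)
        refine h.congr_deriv ?_
        have e1 : y ^ (lam + 1/2) = y ^ (lam + 1/2 - 1) * y := by
          rw [← Real.rpow_add_one hy.1.ne']; congr 1; ring
        rw [e1]
        simp only [hV]
        linear_combination (y ^ (lam + 1/2 - 1)) * (pS B y * oA hy1 - pS A y * oB hy1))
    have h0 : (0:ℝ) ^ (lam + 1/2) = 0 := Real.zero_rpow hc0.ne'
    simp only [h0, zero_mul, sub_zero] at hz'
    have h3 : x ^ (lam + 1/2) * V x = 0 := by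
      have := hz'.symm
      rcases div_eq_zero_iff.1 this with h | h
      · exact h
      · exact absurd h hx0.ne'
    rcases mul_eq_zero.1 h3 with h | h
    · exact absurd h (Real.rpow_pos_of_pos hx0 _).ne'
    · exact h
  -- near zero
  have hBc : ContinuousAt (pS B) 0 := (gB.hasDerivAt (by simp)).continuousAt
  have hB0 : pS B 0 = 1 := by rw [pS_zero, zB]
  have hA0 : pS A 0 = 1 := by rw [pS_zero, zA]
  have hpos : ∀ᶠ y in nhds (0:ℝ), 0 < pS B y := by
    refine hBc.eventually (lt_mem_nhds ?_)
    rw [hB0]; exact one_pos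
  obtain ⟨δ, hδ, hδB⟩ := Metric.eventually_nhds_iff.1 hpos
  have hd : ∀ y : ℝ, |y| < 1 → HasDerivAt (fun y : ℝ => (1 - y) ^ (lam - 1/2) * pS A y)
      ((-1 * (lam - 1/2) * (1 - y) ^ (lam - 1/2 - 1)) * pS A y
        + (1 - y) ^ (lam - 1/2) * pS (fD A) y) y := by
    intro y hy
    have : (1 - y) ≠ 0 := by linarith [(abs_lt.1 hy).2]
    have h1 : HasDerivAt (fun y : ℝ => 1 - y) (-1) y := (hasDerivAt_id y).const_sub 1
    exact (h1.rpow_const (p := lam - 1/2) (Or.inl this)).mul (gA.hasDerivAt hy)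
  have hloc : ∀ y : ℝ, 0 < y → y < δ → y < 1 →
      (1 - y) ^ (lam - 1/2) * pS A y = pS B y := by
    intro y hy0 hyδ hy1
    have hBpos : ∀ t ∈ Set.Icc 0 y, 0 < pS B t := by
      intro t ht
      refine hδB ?_
      rw [Real.dist_eq, sub_zero, abs_of_nonneg ht.1]
      linarith [ht.2]
    obtain ⟨z, hz, hz'⟩ := exists_hasDerivAt_eq_slope
      (fun y : ℝ => (1 - y) ^ (lam - 1/2) * pS A y / pS B y) (fun _ => 0) hy0 (by
        intro t ht
        have ht1 : |t| < 1 := abs_lt.2 ⟨by linarith [ht.1], by linarith [ht.2]⟩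
        exact ((hd t ht1).continuousAt.div (gB.hasDerivAt ht1).continuousAt
          (hBpos t ht).ne').continuousWithinAt) (by
        intro t ht
        have ht1 : |t| < 1 := abs_lt.2 ⟨by linarith [ht.1], by linarith [ht.2]⟩
        have hb := (hBpos t ⟨ht.1.le, ht.2.le⟩).ne'
        refine ((hd t ht1).div (gB.hasDerivAt ht1) hb).congr_deriv ?_
        have e1 : (1 - t) ^ (lam - 1/2) = (1 - t) ^ (lam - 1/2 - 1) * (1 - t) := by
          have : (1 - t) ≠ 0 := by linarith [(abs_lt.1 ht1).2]
          rw [← Real.rpow_add_one this]; congr 1; ring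
        rw [e1, div_eq_zero_iff]
        left
        have := hV0 t ht.1 (abs_lt.1 ht1).2
        simp only [hV] at this
        linear_combination ((1 - t) ^ (lam - 1/2 - 1)) * this)
    simp only [sub_zero, Real.one_rpow, hA0, hB0, one_mul, div_one] at hz'
    have h3 : (1 - y) ^ (lam - 1 / 2) * pS A y / pS B y - 1 = 0 := by
      rcases div_eq_zero_iff.1 hz'.symm with h | h
      · exact h
      · exact absurd h hy0.ne'
    have hb := (hBpos y ⟨hy0.le, le_rfl⟩).ne'
    exact (div_eq_one_iff_eq hb).1 (by linarith)
  -- analytic continuation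
  have an1 : AnalyticOnNhd ℝ (fun y : ℝ => (1 - y) ^ (lam - 1/2) * pS A y) (Set.Ioo (-1) 1) := by
    intro y hy
    refine AnalyticAt.mul ?_ (gA.analytic y hy)
    have h1 : AnalyticAt ℝ (fun y : ℝ => Real.exp (Real.log (1 - y) * (lam - 1/2))) y := by
      have h2 : AnalyticAt ℝ (fun y : ℝ => Real.log (1 - y)) y :=
        AnalyticAt.log (by fun_prop) (by linarith [hy.2])
      exact (h2.mul analyticAt_const).rexp
    refine h1.congr ?_
    filter_upwards [gt_mem_nhds hy.2] with t ht
    rw [Real.rpow_def_of_pos (by linarith)]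
  have := an1.eqOn_of_preconnected_of_frequently_eq gB.analytic isPreconnected_Ioo
    (z₀ := 0) (by norm_num) (by
      have hev : ∀ᶠ y in nhdsWithin (0:ℝ) (Set.Ioi 0),
          (1 - y) ^ (lam - 1/2) * pS A y = pS B y := by
        filter_upwards [Ioo_mem_nhdsGT (show (0:ℝ) < min δ 1 by positivity)] with y hy
        exact hloc y hy.1 (lt_of_lt_of_le hy.2 (min_le_left _ _))
          (lt_of_lt_of_le hy.2 (min_le_right _ _))
      exact hev.frequently.filter_mono (nhdsWithin_mono _ (fun y hy => ne_of_gt hy)))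
  exact this ⟨by linarith, hx1⟩

lemma cos_series {μ : ℝ} (hμ : 0 < μ) {φ : ℝ} (h0 : 0 ≤ φ) (h1 : φ < π) :
    Real.cos (φ/2) * pS (hc (1/2 + μ) (1/2 - μ) (1/2)) (Real.sin (φ/2) ^ 2) = Real.cos (μ * φ) := by
  have hc0 : (0:ℝ) < 1/2 := by norm_num
  have gB := hc_good (1/2 + μ) (1/2 - μ) hc0
  have oB := fun {x : ℝ} (hx : |x| < 1) => ode (1/2 + μ) (1/2 - μ) hc0 hx
  have zB := hc_zero (1/2 + μ) (1/2 - μ) (1/2)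
  generalize hc (1/2 + μ) (1/2 - μ) (1/2) = B at *
  have hs : ∀ t : ℝ, t ∈ Set.Ioo (-π) π → |Real.sin (t/2) ^ 2| < 1 := by
    intro t ht
    have hcp : 0 < Real.cos (t/2) := Real.cos_pos_of_mem_Ioo ⟨by linarith [ht.1], by linarith [ht.2]⟩
    rw [abs_of_nonneg (sq_nonneg _)]
    nlinarith [Real.sin_sq_add_cos_sq (t/2)]
  set v : ℝ → ℝ := fun t => Real.cos (t/2) * pS B (Real.sin (t/2) ^ 2) with hv
  set v' : ℝ → ℝ := fun t => -(1/2) * Real.sin (t/2) * pS B (Real.sin (t/2) ^ 2)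
    + Real.cos (t/2) * (pS (fD B) (Real.sin (t/2) ^ 2) * (Real.sin (t/2) * Real.cos (t/2))) with hv'
  have dh : ∀ t : ℝ, HasDerivAt (fun t : ℝ => t/2) (1/2) t := fun t => (hasDerivAt_id t).div_const 2
  have dsin : ∀ t : ℝ, HasDerivAt (fun t : ℝ => Real.sin (t/2)) (Real.cos (t/2) * (1/2)) t :=
    fun t => (dh t).sin
  have dcos : ∀ t : ℝ, HasDerivAt (fun t : ℝ => Real.cos (t/2)) (-Real.sin (t/2) * (1/2)) t :=
    fun t => (dh t).cos
  have dsq : ∀ t : ℝ, HasDerivAt (fun t : ℝ => Real.sin (t/2) ^ 2)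
      (Real.sin (t/2) * Real.cos (t/2)) t := by
    intro t
    refine ((dsin t).pow 2).congr_deriv ?_
    simp; ring
  have dv : ∀ t ∈ Set.Ioo (-π) π, HasDerivAt v (v' t) t := by
    intro t ht
    have hB : HasDerivAt (fun t : ℝ => pS B (Real.sin (t/2) ^ 2)) _ t :=
      HasDerivAt.comp (h := fun t : ℝ => Real.sin (t/2) ^ 2) t (gB.hasDerivAt (hs t ht)) (dsq t)
    refine ((dcos t).mul hB).congr_deriv ?_
    simp only [hv']; ring
  have dv' : ∀ t ∈ Set.Ioo (-π) π, HasDerivAt v' (-μ ^ 2 * v t) t := by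
    intro t ht
    have hB : HasDerivAt (fun t : ℝ => pS B (Real.sin (t/2) ^ 2)) _ t :=
      HasDerivAt.comp (h := fun t : ℝ => Real.sin (t/2) ^ 2) t (gB.hasDerivAt (hs t ht)) (dsq t)
    have hB' : HasDerivAt (fun t : ℝ => pS (fD B) (Real.sin (t/2) ^ 2)) _ t :=
      HasDerivAt.comp (h := fun t : ℝ => Real.sin (t/2) ^ 2) t (gB.fD.hasDerivAt (hs t ht)) (dsq t)
    refine ((((dsin t).const_mul (-(1/2))).mul hB).add
      ((dcos t).mul (hB'.mul ((dsin t).mul (dcos t))))).congr_deriv ?_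
    have o := oB (hs t ht)
    have hcs : Real.cos (t/2) ^ 2 = 1 - Real.sin (t/2) ^ 2 := by
      linarith [Real.sin_sq_add_cos_sq (t/2)]
    simp only [hv, Pi.mul_apply]
    generalize Real.cos (t/2) = C at *
    generalize Real.sin (t/2) = S at *
    generalize pS B (S ^ 2) = b0 at *
    generalize pS (fD B) (S ^ 2) = b1 at *
    generalize pS (fD (fD B)) (S ^ 2) = b2 at *
    have hC4 : C ^ 3 = C * (1 - S^2) := by rw [← hcs]; ring
    linear_combination C * o + (b2 * S^2 * C + b1 * C / 2) * hcs
  have hmem : ∀ t ∈ Set.Icc 0 φ, t ∈ Set.Ioo (-π) π := fun t ht =>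
    ⟨by linarith [ht.1, Real.pi_pos], by linarith [ht.2]⟩
  have dm : ∀ t : ℝ, HasDerivAt (fun t : ℝ => μ * t) μ t := fun t => by
    simpa using (hasDerivAt_id t).const_mul μ
  have c1 := constant_of_has_deriv_right_zero (a := 0) (b := φ)
    (f := fun t => v t * Real.cos (μ * t) - v' t / μ * Real.sin (μ * t))
    (by
      intro t ht
      have h1 := dv t (hmem t ht)
      have h2 := dv' t (hmem t ht)
      exact ((h1.mul (dm t).cos).sub ((h2.div_const μ).mul (dm t).sin)).continuousAt.continuousWithinAt)
    (by
      intro t ht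
      have h1 := dv t (hmem t ⟨ht.1, ht.2.le⟩)
      have h2 := dv' t (hmem t ⟨ht.1, ht.2.le⟩)
      refine HasDerivAt.hasDerivWithinAt ?_
      refine ((h1.mul (dm t).cos).sub ((h2.div_const μ).mul (dm t).sin)).congr_deriv ?_
      field_simp
      ring) φ ⟨h0, le_rfl⟩
  have c2 := constant_of_has_deriv_right_zero (a := 0) (b := φ)
    (f := fun t => v t * Real.sin (μ * t) + v' t / μ * Real.cos (μ * t))
    (by
      intro t ht
      have h1 := dv t (hmem t ht)
      have h2 := dv' t (hmem t ht)
      exact ((h1.mul (dm t).sin).add ((h2.div_const μ).mul (dm t).cos)).continuousAt.continuousWithinAt)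
    (by
      intro t ht
      have h1 := dv t (hmem t ⟨ht.1, ht.2.le⟩)
      have h2 := dv' t (hmem t ⟨ht.1, ht.2.le⟩)
      refine HasDerivAt.hasDerivWithinAt ?_
      refine ((h1.mul (dm t).sin).add ((h2.div_const μ).mul (dm t).cos)).congr_deriv ?_
      field_simp
      ring) φ ⟨h0, le_rfl⟩
  have hv0 : v 0 = 1 := by simp [hv, pS_zero, zB]
  have hv0' : v' 0 = 0 := by simp [hv']
  simp only [hv0, hv0', mul_zero, Real.cos_zero, Real.sin_zero, zero_div, add_zero, sub_zero,
    mul_one] at c1 c2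
  linear_combination Real.cos (μ * φ) * c1 + Real.sin (μ * φ) * c2
    - v φ * Real.sin_sq_add_cos_sq (μ * φ)
lemma beta_real {p q x : ℝ} (hp : 0 < p) (hq : 0 < q) (hx : 0 < x) :
    ∫ y in Set.Ioo 0 x, y ^ (p - 1) * (x - y) ^ (q - 1) =
      x ^ (p + q - 1) * (Real.Gamma p * Real.Gamma q / Real.Gamma (p + q)) := by
  have h := Complex.betaIntegral_scaled (p : ℂ) (q : ℂ) hx
  rw [Complex.betaIntegral_eq_Gamma_mul_div _ _ (by simpa) (by simpa),
    intervalIntegral.integral_of_le hx.le, MeasureTheory.integral_Ioc_eq_integral_Ioo] at h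
  rw [← Complex.ofReal_inj, ← integral_complex_ofReal]
  rw [← Complex.ofReal_add, Complex.Gamma_ofReal, Complex.Gamma_ofReal, Complex.Gamma_ofReal] at h
  have e1 : (((p + q : ℝ) : ℂ) - 1) = ((p + q - 1 : ℝ) : ℂ) := by push_cast; rfl
  rw [e1, ← Complex.ofReal_cpow hx.le] at h
  push_cast at h ⊢
  rw [← h]
  refine MeasureTheory.setIntegral_congr_fun measurableSet_Ioo ?_
  intro y hy
  simp only
  rw [Complex.ofReal_cpow hy.1.le, Complex.ofReal_cpow (by linarith [hy.2])]
  push_cast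
  rfl

lemma beta_real_integrable {p q x : ℝ} (hp : 0 < p) (hq : 0 < q) (hx : 0 < x) :
    MeasureTheory.IntegrableOn (fun y : ℝ => y ^ (p - 1) * (x - y) ^ (q - 1)) (Set.Ioo 0 x) := by
  refine MeasureTheory.Integrable.of_integral_ne_zero ?_
  rw [beta_real hp hq hx]
  have := Real.Gamma_pos_of_pos hp
  have := Real.Gamma_pos_of_pos hq
  have := Real.Gamma_pos_of_pos (add_pos hp hq)
  positivity

lemma Gamma_poch {c : ℝ} (hc : 0 < c) (n : ℕ) :
    Real.Gamma (n + c) = poch c n * Real.Gamma c := by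
  induction n with
  | zero => simp [poch_zero]
  | succ n ih =>
    have : ((n + 1 : ℕ) : ℝ) + c = (n + c) + 1 := by push_cast; ring
    rw [this, Real.Gamma_add_one (by positivity), ih, poch_succ]
    ring

lemma frac_int (a b : ℝ) {lam x : ℝ} (hl : 0 < lam) (hx : 0 < x) (hx1 : x < 1) :
    ∫ y in Set.Ioo 0 x, y ^ ((1/2 : ℝ) - 1) * (x - y) ^ (lam - 1) * pS (hc a b (1/2)) y =
      x ^ (lam - 1/2) * (Real.sqrt π * Real.Gamma lam / Real.Gamma (lam + 1/2)) *
        pS (hc a b (lam + 1/2)) x := by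
  set K := x ^ (lam - 1/2) * (Real.sqrt π * Real.Gamma lam / Real.Gamma (lam + 1/2)) with hK
  have hG := Real.Gamma_pos_of_pos hl
  have hG2 := Real.Gamma_pos_of_pos (show 0 < lam + 1/2 by positivity)
  have hKpos : 0 < K := by positivity
  have hl2 : 0 < lam + 1/2 := by positivity
  have hm : ∀ n : ℕ, ∫ y in Set.Ioo 0 x, y ^ (((n:ℝ) + 1/2) - 1) * (x - y) ^ (lam - 1) =
      poch (1/2) n / poch (lam + 1/2) n * x ^ n * K := by
    intro n
    rw [beta_real (by positivity) hl hx]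
    have e : (n:ℝ) + 1/2 + lam = n + (lam + 1/2) := by ring
    rw [e, Gamma_poch hl2, Gamma_poch (by norm_num), Real.Gamma_one_half_eq]
    have e2 : (n:ℝ) + (lam + 1/2) - 1 = n + (lam - 1/2) := by ring
    rw [e2, Real.rpow_add hx, Real.rpow_natCast, hK]
    have := (poch_pos hl2 n).ne'
    field_simp
  have hpt : ∀ n : ℕ, ∀ y ∈ Set.Ioo 0 x, y ^ (((n:ℝ) + 1/2) - 1) = y ^ ((1/2:ℝ) - 1) * y ^ n := by
    intro n y hy
    rw [← Real.rpow_natCast, ← Real.rpow_add hy.1]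
    congr 1; ring
  have hcoef : ∀ n : ℕ, hc a b (1/2) n * (poch (1/2) n / poch (lam + 1/2) n) =
      hc a b (lam + 1/2) n := by
    intro n
    unfold hc
    have := (poch_pos hl2 n).ne'
    have := (poch_pos (show (0:ℝ) < 1/2 by norm_num) n).ne'
    field_simp
  have hF_int : ∀ n : ℕ, MeasureTheory.IntegrableOn (fun y : ℝ =>
      hc a b (1/2) n * (y ^ (((n:ℝ) + 1/2) - 1) * (x - y) ^ (lam - 1))) (Set.Ioo 0 x) :=
    fun n => (beta_real_integrable (by positivity) hl hx).const_mul _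
  have hnorm : ∀ n : ℕ, ∫ y in Set.Ioo 0 x,
      ‖hc a b (1/2) n * (y ^ (((n:ℝ) + 1/2) - 1) * (x - y) ^ (lam - 1))‖ =
      |hc a b (lam + 1/2) n| * x ^ n * K := by
    intro n
    have : ∀ y ∈ Set.Ioo 0 x, ‖hc a b (1/2) n * (y ^ (((n:ℝ) + 1/2) - 1) * (x - y) ^ (lam - 1))‖ =
        |hc a b (1/2) n| * (y ^ (((n:ℝ) + 1/2) - 1) * (x - y) ^ (lam - 1)) := by
      intro y hy
      have h1 : 0 ≤ y ^ (((n:ℝ) + 1/2) - 1) := Real.rpow_nonneg hy.1.le _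
      have h2 : 0 ≤ (x - y) ^ (lam - 1) := Real.rpow_nonneg (by linarith [hy.2]) _
      rw [Real.norm_eq_abs, abs_mul, abs_of_nonneg (mul_nonneg h1 h2)]
    rw [MeasureTheory.setIntegral_congr_fun measurableSet_Ioo this,
      MeasureTheory.integral_const_mul, hm, ← hcoef, abs_mul,
      abs_of_pos (div_pos (poch_pos (show (0:ℝ) < 1/2 by norm_num) n) (poch_pos hl2 n))]
    ring
  have key := MeasureTheory.hasSum_integral_of_summable_integral_norm hF_int (by
    simp only [hnorm]
    exact ((hc_good a b hl2) x hx hx1).mul_right K)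
  have e1 : ∫ y in Set.Ioo 0 x, y ^ ((1/2 : ℝ) - 1) * (x - y) ^ (lam - 1) * pS (hc a b (1/2)) y =
      ∫ y in Set.Ioo 0 x, ∑' n : ℕ,
        hc a b (1/2) n * (y ^ (((n:ℝ) + 1/2) - 1) * (x - y) ^ (lam - 1)) := by
    refine MeasureTheory.setIntegral_congr_fun measurableSet_Ioo ?_
    intro y hy
    simp only [pS]
    rw [← tsum_mul_left]
    refine tsum_congr fun n => ?_
    rw [hpt n y hy]
    ring
  rw [e1]
  refine key.unique ?_
  have := ((hc_good a b hl2).hasSum (x := x) (by rwa [abs_of_pos hx])).mul_left K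
  refine this.congr_fun ?_
  intro n
  rw [MeasureTheory.integral_const_mul, hm, ← hcoef]
  ring

lemma img_sinsq {θ : ℝ} (h0 : 0 < θ) (h1 : θ < π) :
    (fun φ : ℝ => Real.sin (φ/2) ^ 2) '' Set.Ioo 0 θ = Set.Ioo 0 (Real.sin (θ/2) ^ 2) ∧
      Set.InjOn (fun φ : ℝ => Real.sin (φ/2) ^ 2) (Set.Ioo 0 θ) := by
  have hmono : StrictMonoOn (fun φ : ℝ => Real.sin (φ/2) ^ 2) (Set.Icc 0 θ) := by
    intro s hs t ht hst
    have a1 : 0 ≤ Real.sin (s/2) := Real.sin_nonneg_of_nonneg_of_le_pi (by linarith [hs.1])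
      (by linarith [hs.2])
    have a2 : Real.sin (s/2) < Real.sin (t/2) := Real.strictMonoOn_sin
      ⟨by linarith [hs.1], by linarith [hs.2]⟩ ⟨by linarith [ht.1], by linarith [ht.2]⟩
      (by linarith)
    simp only
    exact pow_lt_pow_left₀ a2 a1 (by norm_num)
  refine ⟨?_, (hmono.mono Set.Ioo_subset_Icc_self).injOn⟩
  have hcont : ContinuousOn (fun φ : ℝ => Real.sin (φ/2) ^ 2) (Set.Icc 0 θ) := by fun_prop
  apply Set.Subset.antisymm
  · rintro _ ⟨t, ht, rfl⟩
    have b1 := hmono ⟨le_rfl, h0.le⟩ ⟨ht.1.le, ht.2.le⟩ ht.1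
    have b2 := hmono ⟨ht.1.le, ht.2.le⟩ ⟨h0.le, le_rfl⟩ ht.2
    simp at b1
    exact ⟨by simpa using b1, b2⟩
  · have := intermediate_value_Ioo h0.le hcont
    simpa using this

lemma dsinsq (t : ℝ) : HasDerivAt (fun t : ℝ => Real.sin (t/2) ^ 2)
      (Real.sin (t/2) * Real.cos (t/2)) t := by
  have h := (((hasDerivAt_id t).div_const 2).sin).pow 2
  refine h.congr_deriv ?_
  simp; ring

/-- pointwise substitution identity -/
lemma subst_pt {lam θ φ : ℝ} (h1 : θ < π) (hφ : φ ∈ Set.Ioo 0 θ) :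
    |Real.sin (φ/2) * Real.cos (φ/2)| * ((Real.sin (φ/2) ^ 2) ^ ((1/2:ℝ) - 1) *
      (Real.sin (θ/2) ^ 2 - Real.sin (φ/2) ^ 2) ^ (lam - 1)) =
    Real.cos (φ/2) * (2 ^ (1 - lam) * (Real.cos φ - Real.cos θ) ^ (lam - 1)) := by
  have a1 : 0 < Real.sin (φ/2) := Real.sin_pos_of_pos_of_lt_pi (by linarith [hφ.1])
      (by linarith [hφ.1, hφ.2])
  have a2 : 0 < Real.cos (φ/2) :=
    Real.cos_pos_of_mem_Ioo ⟨by linarith [hφ.1, hφ.2], by linarith [hφ.1, hφ.2]⟩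
  have a3 : Real.cos θ < Real.cos φ :=
    Real.cos_lt_cos_of_nonneg_of_le_pi hφ.1.le h1.le hφ.2
  have e1 : (Real.sin (φ/2) ^ 2) ^ ((1/2:ℝ) - 1) = (Real.sin (φ/2))⁻¹ := by
    rw [← Real.rpow_natCast, ← Real.rpow_mul a1.le, ← Real.rpow_neg_one]
    congr 1; norm_num
  have e2 : Real.sin (θ/2) ^ 2 - Real.sin (φ/2) ^ 2 = (Real.cos φ - Real.cos θ) * 2⁻¹ := by
    rw [Real.sin_sq_eq_half_sub, Real.sin_sq_eq_half_sub]
    rw [mul_div_cancel₀ _ two_ne_zero, mul_div_cancel₀ _ two_ne_zero]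
    ring
  rw [e1, e2, Real.mul_rpow (by linarith) (by norm_num), abs_of_pos (mul_pos a1 a2),
    Real.inv_rpow (by norm_num), ← Real.rpow_neg (by norm_num), neg_sub]
  field_simp

lemma mehler (lam nu : ℝ) (hl : 0 < lam) (hmu : 0 < nu + lam) {θ : ℝ} (h0 : 0 < θ) (h1 : θ < π) :
    ∫ φ in Set.Ioo 0 θ, Real.cos ((nu + lam) * φ) * (Real.cos φ - Real.cos θ) ^ (lam - 1) =
      (Real.sqrt π * Real.Gamma lam / (2 ^ lam * Real.Gamma (lam + 1/2))) *
        (Real.sin θ ^ (2 * lam - 1) * rG lam nu (Real.cos θ)) := by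
  set μ := nu + lam with hμ
  set x := Real.sin (θ/2) ^ 2 with hx
  have s1 : 0 < Real.sin (θ/2) := Real.sin_pos_of_pos_of_lt_pi (by linarith) (by linarith)
  have c1 : 0 < Real.cos (θ/2) := Real.cos_pos_of_mem_Ioo ⟨by linarith, by linarith⟩
  have hx0 : 0 < x := by positivity
  have hcx : Real.cos (θ/2) ^ 2 = 1 - x := by
    rw [hx]; linarith [Real.sin_sq_add_cos_sq (θ/2)]
  have hx1 : x < 1 := by nlinarith
  obtain ⟨him, hinj⟩ := img_sinsq h0 h1
  have A := frac_int (1/2 + μ) (1/2 - μ) hl hx0 hx1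
  rw [hx, ← him, MeasureTheory.integral_image_eq_integral_abs_deriv_smul measurableSet_Ioo
    (fun t _ => (dsinsq t).hasDerivWithinAt) hinj] at A
  have B : ∀ φ ∈ Set.Ioo 0 θ, |Real.sin (φ / 2) * Real.cos (φ / 2)| •
      ((Real.sin (φ / 2) ^ 2) ^ ((1 / 2 : ℝ) - 1) *
        (Real.sin (θ / 2) ^ 2 - Real.sin (φ / 2) ^ 2) ^ (lam - 1) *
        pS (hc (1 / 2 + μ) (1 / 2 - μ) (1 / 2)) (Real.sin (φ / 2) ^ 2)) =
      2 ^ (1 - lam) * (Real.cos (μ * φ) * (Real.cos φ - Real.cos θ) ^ (lam - 1)) := by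
    intro φ hφ
    rw [smul_eq_mul, ← mul_assoc, subst_pt h1 hφ, ← cos_series hmu hφ.1.le (hφ.2.trans h1)]
    ring
  rw [MeasureTheory.setIntegral_congr_fun measurableSet_Ioo B, MeasureTheory.integral_const_mul,
    ← hx, hμ, ← euler_transform lam nu hl hx0.le hx1] at A
  have hG : rG lam nu (Real.cos θ) = pS (hc (-nu) (nu + 2 * lam) (lam + 1/2)) x := by
    unfold rG pS hc
    refine tsum_congr fun n => ?_
    have : (1 - Real.cos θ) / 2 = x := by
      rw [hx, Real.sin_sq_eq_half_sub, mul_div_cancel₀ _ two_ne_zero]; ring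
    rw [this]
  rw [← hG] at A
  have hs : Real.sin θ ^ (2 * lam - 1) =
      2 ^ (2 * lam - 1) * (x ^ (lam - 1/2) * (1 - x) ^ (lam - 1/2)) := by
    have e : Real.sin θ = 2 * (Real.sin (θ/2) * Real.cos (θ/2)) := by
      rw [← mul_assoc, ← Real.sin_two_mul]; congr 1; ring
    have e2 : 2 * lam - 1 = ((2:ℕ):ℝ) * (lam - 1/2) := by push_cast; ring
    have e3 : x ^ (lam - 1/2) = Real.sin (θ/2) ^ (2 * lam - 1) := by
      rw [hx, e2, Real.rpow_mul s1.le, Real.rpow_natCast]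
    have e4 : (1 - x) ^ (lam - 1/2) = Real.cos (θ/2) ^ (2 * lam - 1) := by
      rw [← hcx, e2, Real.rpow_mul c1.le, Real.rpow_natCast]
    rw [e3, e4, e, Real.mul_rpow (by norm_num) (by positivity), Real.mul_rpow s1.le c1.le]
  have h2 : (2:ℝ) ^ (1 - lam) = 2 / 2 ^ lam := by
    rw [Real.rpow_sub two_pos, Real.rpow_one]
  have h3 : (2:ℝ) ^ (2 * lam - 1) = 2 ^ lam * 2 ^ lam / 2 := by
    rw [Real.rpow_sub two_pos, Real.rpow_one, two_mul, Real.rpow_add two_pos]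
  rw [h2] at A
  rw [hs, h3]
  have p2 : (0:ℝ) < 2 ^ lam := by positivity
  have hG2 := Real.Gamma_pos_of_pos (show 0 < lam + 1/2 by positivity)
  generalize ∫ φ in Set.Ioo 0 θ, Real.cos ((nu + lam) * φ) * (Real.cos φ - Real.cos θ) ^ (lam - 1)
    = I at *
  have A' : I = (2 ^ lam / 2) * (x ^ (lam - 1 / 2) *
      (√π * Real.Gamma lam / Real.Gamma (lam + 1 / 2)) *
      ((1 - x) ^ (lam - 1 / 2) * rG lam nu (Real.cos θ))) := by
    rw [← A]; field_simp
  rw [A']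
  generalize (2:ℝ) ^ lam = T at *
  generalize x ^ (lam - 1/2) = X at *
  generalize (1 - x) ^ (lam - 1/2) = Y at *
  generalize Real.Gamma (lam + 1/2) = G at *
  field_simp

lemma mehler_integrable {lam : ℝ} (hl : 0 < lam) {θ : ℝ} (h0 : 0 < θ) (h1 : θ < π) :
    MeasureTheory.IntegrableOn (fun φ : ℝ => (Real.cos φ - Real.cos θ) ^ (lam - 1))
      (Set.Ioo 0 θ) := by
  have s1 : 0 < Real.sin (θ/2) := Real.sin_pos_of_pos_of_lt_pi (by linarith) (by linarith)
  have c1 : 0 < Real.cos (θ/2) := Real.cos_pos_of_mem_Ioo ⟨by linarith, by linarith⟩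
  obtain ⟨him, hinj⟩ := img_sinsq h0 h1
  have A := beta_real_integrable (p := 1/2) (x := Real.sin (θ/2) ^ 2) (by norm_num) hl
    (by positivity)
  rw [← him, MeasureTheory.integrableOn_image_iff_integrableOn_abs_deriv_smul measurableSet_Ioo
    (fun t _ => (dsinsq t).hasDerivWithinAt) hinj] at A
  have A' := A.const_mul ((Real.cos (θ/2))⁻¹ * 2 ^ (lam - 1))
  refine MeasureTheory.Integrable.mono' A' ?_ ?_
  · refine Measurable.aestronglyMeasurable ?_
    fun_prop
  · refine (MeasureTheory.ae_restrict_iff' measurableSet_Ioo).2 (Filter.Eventually.of_forall ?_)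
    intro φ hφ
    rw [smul_eq_mul, subst_pt h1 hφ]
    have a3 : Real.cos θ < Real.cos φ :=
      Real.cos_lt_cos_of_nonneg_of_le_pi hφ.1.le h1.le hφ.2
    have a4 : Real.cos (θ/2) ≤ Real.cos (φ/2) :=
      Real.cos_le_cos_of_nonneg_of_le_pi (by linarith [hφ.1]) (by linarith) (by linarith [hφ.2])
    have p : 0 ≤ (Real.cos φ - Real.cos θ) ^ (lam - 1) := Real.rpow_nonneg (by linarith) _
    rw [Real.norm_eq_abs, abs_of_nonneg p]
    have e : (2:ℝ) ^ (lam - 1) * 2 ^ (1 - lam) = 1 := by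
      rw [← Real.rpow_add two_pos]; simp
    have : (Real.cos (θ / 2))⁻¹ * 2 ^ (lam - 1) *
        (Real.cos (φ / 2) * (2 ^ (1 - lam) * (Real.cos φ - Real.cos θ) ^ (lam - 1))) =
        (Real.cos (φ/2) / Real.cos (θ/2)) * (Real.cos φ - Real.cos θ) ^ (lam - 1) := by
      rw [div_eq_mul_inv (Real.cos (φ/2))]
      generalize (Real.cos (θ / 2))⁻¹ = D at *
      linear_combination (D * Real.cos (φ/2) *
        (Real.cos φ - Real.cos θ) ^ (lam - 1)) * e
    rw [this]
    exact le_mul_of_one_le_left p ((one_le_div c1).2 a4)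
/-- `cos (φ + i y) - cos θ`. -/
noncomputable def cw (θ φ y : ℝ) : ℂ := Complex.cos ((φ : ℂ) + (y : ℂ) * Complex.I) - (Real.cos θ : ℂ)

lemma cw_eq (θ φ y : ℝ) : cw θ φ y =
    ((Real.cos φ * Real.cosh y - Real.cos θ : ℝ) : ℂ) - ((Real.sin φ * Real.sinh y : ℝ) : ℂ) * Complex.I := by
  unfold cw
  rw [Complex.cos_add_mul_I]
  push_cast
  ring

lemma cw_re (θ φ y : ℝ) : (cw θ φ y).re = Real.cos φ * Real.cosh y - Real.cos θ := by
  rw [cw_eq]; simp only [Complex.sub_re, Complex.sub_im, Complex.ofReal_re, Complex.mul_re, Complex.mul_im, Complex.I_re, Complex.I_im, Complex.ofReal_im]; ring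

lemma cw_im (θ φ y : ℝ) : (cw θ φ y).im = - (Real.sin φ * Real.sinh y) := by
  rw [cw_eq]; simp only [Complex.sub_re, Complex.sub_im, Complex.ofReal_re, Complex.mul_re, Complex.mul_im, Complex.I_re, Complex.I_im, Complex.ofReal_im]; ring

lemma cw_normsq (θ φ y : ℝ) : ‖cw θ φ y‖ ^ 2 =
    (Real.cos φ * Real.cosh y - Real.cos θ) ^ 2 + (1 - Real.cos φ ^ 2) * (Real.cosh y ^ 2 - 1) := by
  rw [← Complex.normSq_eq_norm_sq, Complex.normSq_apply, cw_re, cw_im]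
  have h1 := Real.sin_sq_add_cos_sq φ
  have h2 := Real.cosh_sq y
  have h3 : 1 - Real.cos φ ^ 2 = Real.sin φ ^ 2 := by linarith
  have h4 : Real.cosh y ^ 2 - 1 = Real.sinh y ^ 2 := by linarith
  rw [h3, h4]; ring

lemma cos_cos_le (θ φ : ℝ) : |Real.cos φ * Real.cos θ| ≤ 1 := by
  rw [abs_mul]
  exact mul_le_one₀ (Real.abs_cos_le_one _) (abs_nonneg _) (Real.abs_cos_le_one _)

lemma cw_lower1 (θ φ y : ℝ) : Real.cos φ - Real.cos θ ≤ ‖cw θ φ y‖ := by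
  refine le_of_sq_le_sq ?_ (norm_nonneg _)
  rw [cw_normsq]
  have h1 := (abs_le.1 (cos_cos_le θ φ)).2
  have h2 := Real.one_le_cosh y
  nlinarith [mul_nonneg (sub_nonneg.2 h2) (show 0 ≤ Real.cosh y + 1 - 2 * (Real.cos φ * Real.cos θ) by linarith)]

lemma cw_lower2 (θ φ y : ℝ) : Real.cosh y - 1 ≤ ‖cw θ φ y‖ := by
  refine le_of_sq_le_sq ?_ (norm_nonneg _)
  rw [cw_normsq]
  have h1 := (abs_le.1 (cos_cos_le θ φ)).2
  have h2 := Real.one_le_cosh y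
  nlinarith [mul_nonneg (sub_nonneg.2 h2) (sub_nonneg.2 h1), sq_nonneg (Real.cos φ - Real.cos θ)]

lemma cw_upper (θ φ y : ℝ) : ‖cw θ φ y‖ ≤ Real.cosh y + 1 := by
  have h2 := Real.one_le_cosh y
  refine le_of_sq_le_sq ?_ (by linarith)
  rw [cw_normsq]
  have h1 := (abs_le.1 (cos_cos_le θ φ)).1
  nlinarith [mul_nonneg (show 0 ≤ Real.cosh y by linarith) (show 0 ≤ 1 + Real.cos φ * Real.cos θ by linarith),
    Real.cos_sq_le_one φ, Real.cos_sq_le_one θ]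

lemma cw_slit {θ φ y : ℝ} (h0 : 0 < θ) (h1 : θ < π) (hφ : 0 ≤ φ) (hφ' : φ ≤ θ) (hy : 0 < y) :
    cw θ φ y ∈ Complex.slitPlane := by
  rw [Complex.mem_slitPlane_iff]
  rcases hφ.eq_or_lt with h | h
  · left
    rw [cw_re, ← h, Real.cos_zero, one_mul]
    have := Real.one_le_cosh y
    have : Real.cos θ < Real.cos 0 := Real.cos_lt_cos_of_nonneg_of_le_pi le_rfl h1.le h0
    rw [Real.cos_zero] at this
    linarith
  · right
    rw [cw_im]
    have := Real.sin_pos_of_pos_of_lt_pi h (by linarith)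
    have := Real.sinh_pos_iff.2 hy
    exact neg_ne_zero.2 (by positivity)

/-- The integrand on the complex plane. -/
noncomputable def cf (μ r θ : ℝ) (z : ℂ) : ℂ :=
  Complex.exp (Complex.I * (μ : ℂ) * z) * (Complex.cos z - (Real.cos θ : ℂ)) ^ ((r : ℝ) : ℂ)

lemma cf_norm (μ r θ φ y : ℝ) : ‖cf μ r θ ((φ : ℂ) + (y : ℂ) * Complex.I)‖ =
    Real.exp (-(μ * y)) * ‖cw θ φ y‖ ^ r := by
  unfold cf
  rw [norm_mul, Complex.norm_cpow_real, Complex.norm_exp]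
  congr 2
  simp

lemma cf_diff {μ r θ : ℝ} (h0 : 0 < θ) (h1 : θ < π) {z : ℂ} (hz0 : 0 ≤ z.re) (hz1 : z.re ≤ θ)
    (hz : 0 < z.im) : DifferentiableAt ℂ (cf μ r θ) z := by
  have hs := cw_slit h0 h1 hz0 hz1 hz
  unfold cw at hs
  rw [Complex.re_add_im] at hs
  unfold cf
  refine DifferentiableAt.mul (by fun_prop) ?_
  refine DifferentiableAt.cpow_const ?_ hs
  exact Complex.differentiableAt_cos.sub_const _

lemma rp_bound {m w r : ℝ} (hm : 0 < m) (hw : m ≤ w) (hr : r ≤ 1) : w ^ r ≤ m ^ r + (w + 1) := by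
  have hw0 : 0 < w := hm.trans_le hw
  rcases le_total r 0 with h | h
  · have := Real.rpow_le_rpow_of_nonpos hm hw h
    linarith
  · have h2 : 0 ≤ m ^ r := by positivity
    rcases le_total w 1 with h1 | h1
    · have := Real.rpow_le_one hw0.le h1 h
      linarith
    · have := Real.rpow_le_rpow_of_exponent_le h1 hr
      rw [Real.rpow_one] at this
      linarith

lemma rect {μ r θ ε T : ℝ} (h0 : 0 < θ) (h1 : θ < π) (hε : 0 < ε) (hT : ε ≤ T) :
    (∫ φ : ℝ in Set.Ioo 0 θ, cf μ r θ ((φ:ℂ) + (ε:ℂ) * Complex.I)).re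
      - (∫ φ : ℝ in Set.Ioo 0 θ, cf μ r θ ((φ:ℂ) + (T:ℂ) * Complex.I)).re
      = (∫ y : ℝ in ε..T, cf μ r θ ((θ:ℂ) + (y:ℂ) * Complex.I)).im := by
  have h := Complex.integral_boundary_rect_eq_zero_of_differentiableOn (cf μ r θ)
    (⟨0, ε⟩ : ℂ) (⟨θ, T⟩ : ℂ) (by
      intro z hz
      rw [Complex.mem_reProdIm] at hz
      simp only [Set.uIcc_of_le h0.le, Set.uIcc_of_le hT] at hz
      exact (cf_diff h0 h1 hz.1.1 hz.1.2 (lt_of_lt_of_le hε hz.2.1)).differentiableWithinAt)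
  simp only at h
  rw [intervalIntegral.integral_of_le h0.le, intervalIntegral.integral_of_le h0.le,
    MeasureTheory.integral_Ioc_eq_integral_Ioo, MeasureTheory.integral_Ioc_eq_integral_Ioo] at h
  have hreal : ∀ y ∈ Set.uIcc ε T, cf μ r θ (((0:ℝ):ℂ) + (y:ℂ) * Complex.I) =
      ((Real.exp (-(μ * y)) * (Real.cosh y - Real.cos θ) ^ r : ℝ) : ℂ) := by
    intro y hy
    have hp : 0 ≤ Real.cosh y - Real.cos θ := by
      linarith [Real.one_le_cosh y, Real.cos_le_one θ]
    unfold cf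
    rw [Complex.ofReal_mul, Complex.ofReal_cpow hp, Complex.ofReal_exp]
    congr 2
    · push_cast
      linear_combination (μ * y : ℂ) * Complex.I_mul_I
    · simp [Complex.cos_mul_I]
  rw [intervalIntegral.integral_congr hreal, intervalIntegral.integral_ofReal] at h
  have h2 := congrArg Complex.re h
  simp only [Complex.sub_re, Complex.add_re, Complex.zero_re, smul_eq_mul, Complex.mul_re,
    Complex.I_re, Complex.I_im, zero_mul, one_mul, Complex.ofReal_im, zero_sub, sub_zero,
    neg_zero] at h2
  linarith

lemma top_lim {μ r θ : ℝ} (h0 : 0 < θ) (hμ : 1 < μ) (hr : r ≤ 1) :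
    Filter.Tendsto (fun T : ℝ => ∫ φ : ℝ in Set.Ioo 0 θ, cf μ r θ ((φ:ℂ) + (T:ℂ) * Complex.I))
      Filter.atTop (nhds 0) := by
  have hlim : Filter.Tendsto (fun T : ℝ => 2 * Real.exp (-((μ - 1) * T)) * θ) Filter.atTop (nhds 0) := by
    have : Filter.Tendsto (fun T : ℝ => (μ - 1) * T) Filter.atTop Filter.atTop :=
      Filter.tendsto_id.const_mul_atTop (by linarith)
    have := ((Real.tendsto_exp_neg_atTop_nhds_zero.comp this).const_mul 2).mul_const θ
    simpa using this
  refine squeeze_zero_norm' ?_ hlim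
  filter_upwards [Filter.eventually_ge_atTop 2] with T hT
  have hcosh : 2 ≤ Real.cosh T := by
    have e := Real.cosh_eq T
    have e1 := Real.quadratic_le_exp_of_nonneg (x := T) (by linarith)
    have e2 := Real.exp_pos (-T)
    nlinarith
  have hexp : Real.cosh T + 1 ≤ 2 * Real.exp T := by
    have e := Real.cosh_eq T
    have e1 := Real.add_one_le_exp T
    have e2 : Real.exp (-T) ≤ 1 := Real.exp_le_one_iff.2 (by linarith)
    linarith
  have := MeasureTheory.norm_setIntegral_le_of_norm_le_const (μ := MeasureTheory.volume)
    (s := Set.Ioo 0 θ) (C := 2 * Real.exp (-((μ - 1) * T)))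
    (f := fun φ : ℝ => cf μ r θ ((φ:ℂ) + (T:ℂ) * Complex.I)) (by simp) (by
      intro φ _
      rw [cf_norm]
      have hw1 : 1 ≤ ‖cw θ φ T‖ := by linarith [cw_lower2 θ φ T]
      have hw2 := cw_upper θ φ T
      have h3 := Real.rpow_le_rpow_of_exponent_le hw1 hr
      rw [Real.rpow_one] at h3
      have e : 2 * Real.exp (-((μ - 1) * T)) = Real.exp (-(μ * T)) * (2 * Real.exp T) := by
        have : -((μ - 1) * T) = -(μ * T) + T := by ring
        rw [this, Real.exp_add]; ring
      rw [e]
      gcongr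
      linarith)
  refine this.trans (le_of_eq ?_)
  simp [h0.le]

lemma bot_lim {μ r θ : ℝ} (h0 : 0 < θ) (h1 : θ < π) (hμ : 0 < μ) (hr : r ≤ 1) (hr1 : -1 < r) :
    Filter.Tendsto (fun ε : ℝ => ∫ φ : ℝ in Set.Ioo 0 θ, cf μ r θ ((φ:ℂ) + (ε:ℂ) * Complex.I))
      (nhdsWithin 0 (Set.Ioi 0)) (nhds (∫ φ : ℝ in Set.Ioo 0 θ, cf μ r θ (φ:ℂ))) := by
  have hI := mehler_integrable (lam := r + 1) (by linarith) h0 h1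
  rw [add_sub_cancel_right] at hI
  have hmem : Set.Ioo (0:ℝ) 1 ∈ nhdsWithin (0:ℝ) (Set.Ioi 0) := Ioo_mem_nhdsGT one_pos
  refine MeasureTheory.tendsto_integral_filter_of_dominated_convergence
    (fun φ => (Real.cos φ - Real.cos θ) ^ r + ((Real.cosh 1 + 1) + 1)) ?_ ?_ ?_ ?_
  · filter_upwards [hmem] with ε hε
    refine ContinuousOn.aestronglyMeasurable ?_ measurableSet_Ioo
    intro φ hφ
    refine ContinuousAt.continuousWithinAt ?_
    refine ContinuousAt.comp (f := fun φ : ℝ => ((φ:ℂ) + (ε:ℂ) * Complex.I)) (g := cf μ r θ) ?_ (by fun_prop)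
    refine (cf_diff h0 h1 ?_ ?_ ?_).continuousAt
    · simpa using hφ.1.le
    · simpa using hφ.2.le
    · simpa using hε.1
  · filter_upwards [hmem] with ε hε
    refine (MeasureTheory.ae_restrict_iff' measurableSet_Ioo).2 (Filter.Eventually.of_forall ?_)
    intro φ hφ
    rw [cf_norm]
    have a3 : Real.cos θ < Real.cos φ :=
      Real.cos_lt_cos_of_nonneg_of_le_pi hφ.1.le h1.le hφ.2
    have b1 := rp_bound (sub_pos.2 a3) (cw_lower1 θ φ ε) hr
    have b2 := cw_upper θ φ ε
    have b3 : Real.cosh ε ≤ Real.cosh 1 := by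
      rw [Real.cosh_le_cosh, abs_of_pos hε.1, abs_one]; exact hε.2.le
    have b4 : Real.exp (-(μ * ε)) ≤ 1 := Real.exp_le_one_iff.2 (by nlinarith [hε.1])
    have b5 : 0 ≤ ‖cw θ φ ε‖ ^ r := by positivity
    have b6 : Real.exp (-(μ * ε)) * ‖cw θ φ ε‖ ^ r ≤ ‖cw θ φ ε‖ ^ r := mul_le_of_le_one_left b5 b4
    linarith
  · exact hI.add (MeasureTheory.integrableOn_const (by simp))
  · refine (MeasureTheory.ae_restrict_iff' measurableSet_Ioo).2 (Filter.Eventually.of_forall ?_)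
    intro φ hφ
    have a3 : Real.cos θ < Real.cos φ :=
      Real.cos_lt_cos_of_nonneg_of_le_pi hφ.1.le h1.le hφ.2
    have hcont : ContinuousAt (fun ε : ℝ => cf μ r θ ((φ:ℂ) + (ε:ℂ) * Complex.I)) 0 := by
      refine ContinuousAt.comp (f := fun ε : ℝ => ((φ:ℂ) + (ε:ℂ) * Complex.I)) (g := cf μ r θ) ?_ (by fun_prop)
      unfold cf
      simp only [Complex.ofReal_zero, zero_mul, add_zero]
      refine ContinuousAt.mul (by fun_prop) ?_
      refine ContinuousAt.cpow (by fun_prop) continuousAt_const ?_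
      rw [← Complex.ofReal_cos, ← Complex.ofReal_sub]
      exact Complex.ofReal_mem_slitPlane.2 (by linarith)
    have := hcont.tendsto
    simp only [Complex.ofReal_zero, zero_mul, add_zero] at this
    exact this.mono_left nhdsWithin_le_nhds

lemma bot_re {μ r θ : ℝ} (h0 : 0 < θ) (h1 : θ < π) (hr1 : -1 < r) :
    (∫ φ : ℝ in Set.Ioo 0 θ, cf μ r θ (φ:ℂ)).re =
      ∫ φ : ℝ in Set.Ioo 0 θ, Real.cos (μ * φ) * (Real.cos φ - Real.cos θ) ^ r := by
  have hI := mehler_integrable (lam := r + 1) (by linarith) h0 h1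
  rw [add_sub_cancel_right] at hI
  have hpt : ∀ φ ∈ Set.Ioo 0 θ, cf μ r θ (φ:ℂ) =
      Complex.exp (((μ * φ : ℝ) : ℂ) * Complex.I) * (((Real.cos φ - Real.cos θ) ^ r : ℝ) : ℂ) := by
    intro φ hφ
    have a3 : Real.cos θ < Real.cos φ :=
      Real.cos_lt_cos_of_nonneg_of_le_pi hφ.1.le h1.le hφ.2
    unfold cf
    rw [Complex.ofReal_cpow (by linarith)]
    push_cast
    congr 2
    ring
  have hint : MeasureTheory.IntegrableOn (fun φ : ℝ => cf μ r θ (φ:ℂ)) (Set.Ioo 0 θ) := by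
    rw [MeasureTheory.integrableOn_congr_fun hpt measurableSet_Ioo]
    refine MeasureTheory.Integrable.mono' hI ?_ ?_
    · refine MeasureTheory.AEStronglyMeasurable.mul ?_ ?_
      · exact Continuous.aestronglyMeasurable (by fun_prop)
      · exact Complex.continuous_ofReal.comp_aestronglyMeasurable hI.1
    · refine (MeasureTheory.ae_restrict_iff' measurableSet_Ioo).2 (Filter.Eventually.of_forall ?_)
      intro φ hφ
      have a3 : Real.cos θ < Real.cos φ :=
        Real.cos_lt_cos_of_nonneg_of_le_pi hφ.1.le h1.le hφ.2
      rw [norm_mul, Complex.norm_exp_ofReal_mul_I, one_mul, Complex.norm_real, Real.norm_eq_abs,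
        abs_of_nonneg (Real.rpow_nonneg (by linarith) _)]
  have := (RCLike.reCLM (K := ℂ)).integral_comp_comm hint
  simp only [RCLike.reCLM_apply, RCLike.re_eq_complex_re] at this
  rw [← this]
  refine MeasureTheory.setIntegral_congr_fun measurableSet_Ioo ?_
  intro φ hφ
  simp only
  rw [hpt φ hφ, Complex.re_mul_ofReal, Complex.exp_ofReal_mul_I_re]

lemma contour {μ r θ : ℝ} (h0 : 0 < θ) (h1 : θ < π) (hμ : 1 < μ) (hr : r ≤ 1) (hr1 : -1 < r)
    (hint : MeasureTheory.IntegrableOn (fun y : ℝ => cf μ r θ ((θ:ℂ) + (y:ℂ) * Complex.I)) (Set.Ioi 0)) :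
    ∫ φ : ℝ in Set.Ioo 0 θ, Real.cos (μ * φ) * (Real.cos φ - Real.cos θ) ^ r =
      (∫ y : ℝ in Set.Ioi 0, cf μ r θ ((θ:ℂ) + (y:ℂ) * Complex.I)).im := by
  rw [← bot_re h0 h1 hr1]
  have L1 := bot_lim h0 h1 (by linarith) hr hr1 (μ := μ)
  have hinv : Filter.Tendsto (fun ε : ℝ => ε⁻¹) (nhdsWithin 0 (Set.Ioi 0)) Filter.atTop :=
    tendsto_inv_nhdsGT_zero
  have L2 := (top_lim (r := r) h0 hμ hr).comp hinv
  set g : ℝ → ℂ := Set.indicator (Set.Ioi 0) (fun y : ℝ => cf μ r θ ((θ:ℂ) + (y:ℂ) * Complex.I)) with hg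
  have gint : MeasureTheory.Integrable g := (MeasureTheory.integrable_indicator_iff measurableSet_Ioi).2 hint
  have gii : ∀ a b : ℝ, IntervalIntegrable g MeasureTheory.volume a b := fun a b => gint.intervalIntegrable
  have L3 : Filter.Tendsto (fun ε : ℝ => (∫ y in (0:ℝ)..ε⁻¹, g y) - ∫ y in (0:ℝ)..ε, g y)
      (nhdsWithin 0 (Set.Ioi 0)) (nhds ((∫ y in Set.Ioi 0, g y) - 0)) := by
    refine Filter.Tendsto.sub ?_ ?_
    · exact MeasureTheory.intervalIntegral_tendsto_integral_Ioi 0 gint.integrableOn hinv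
    · have := (intervalIntegral.continuous_primitive gii 0).tendsto 0
      rw [intervalIntegral.integral_same] at this
      exact this.mono_left nhdsWithin_le_nhds
  have hgI : ∫ y in Set.Ioi 0, g y = ∫ y : ℝ in Set.Ioi 0, cf μ r θ ((θ:ℂ) + (y:ℂ) * Complex.I) := by
    refine MeasureTheory.setIntegral_congr_fun measurableSet_Ioi ?_
    intro y hy
    simp only [hg]
    rw [Set.indicator_of_mem hy]
  rw [hgI, sub_zero] at L3
  have R1 := (Complex.continuous_re.tendsto _).comp L1
  have R2 := (Complex.continuous_re.tendsto _).comp L2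
  have R3 := (Complex.continuous_im.tendsto _).comp L3
  have R := R1.sub R2
  rw [Complex.zero_re, sub_zero] at R
  refine tendsto_nhds_unique R (R3.congr' ?_)
  filter_upwards [Ioo_mem_nhdsGT one_pos] with ε hε
  have hle : ε ≤ ε⁻¹ := hε.2.le.trans ((one_le_inv₀ hε.1).2 hε.2.le)
  simp only [Function.comp]
  rw [rect h0 h1 hε.1 hle, intervalIntegral.integral_interval_sub_left (gii _ _) (gii _ _)]
  congr 1
  refine intervalIntegral.integral_congr ?_
  intro y hy
  rw [Set.uIcc_of_le hle] at hy
  simp only [hg]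
  rw [Set.indicator_of_mem (show y ∈ Set.Ioi (0:ℝ) from lt_of_lt_of_le hε.1 hy.1)]

lemma cpow_mvt {m r : ℝ} (hm : 0 < m) (hr : r ≤ 1) {w w0 : ℂ} (hw : w.im ≤ -m) (hw0 : w0.im ≤ -m) :
    ‖w ^ ((r : ℝ) : ℂ) - w0 ^ ((r : ℝ) : ℂ)‖ ≤ |r| * m ^ (r - 1) * ‖w - w0‖ := by
  refine Convex.norm_image_sub_le_of_norm_hasDerivWithin_le (s := {c : ℂ | c.im ≤ -m})
    (f := fun z : ℂ => z ^ ((r : ℝ) : ℂ)) (f' := fun z => (r : ℂ) * z ^ ((r : ℂ) - 1)) ?_ ?_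
    (convex_halfSpace_im_le _) hw0 hw
  · intro x hx
    have hx' : x.im ≤ -m := hx
    refine (Complex.hasStrictDerivAt_cpow_const ?_).hasDerivAt.hasDerivWithinAt
    rw [Complex.mem_slitPlane_iff]
    right
    linarith
  · intro x hx
    have hx' : x.im ≤ -m := hx
    have h1 : m ≤ ‖x‖ := by
      have := Complex.abs_im_le_norm x
      rw [abs_of_neg (by linarith)] at this
      linarith
    have h2 : (r : ℂ) - 1 = ((r - 1 : ℝ) : ℂ) := by push_cast; ring
    rw [norm_mul, Complex.norm_real, Real.norm_eq_abs, h2, Complex.norm_cpow_real]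
    exact mul_le_mul_of_nonneg_left (Real.rpow_le_rpow_of_nonpos hm h1 (by linarith)) (abs_nonneg _)

lemma cosh_sub_one_le {t : ℝ} (ht : 0 ≤ t) : Real.cosh t - 1 ≤ t ^ 2 * Real.exp t / 2 := by
  have h1 := Real.add_one_le_exp (-t)
  have h0 := Real.exp_pos t
  have hm := Real.exp_pos (-t)
  have hp : Real.exp t * Real.exp (-t) = 1 := by rw [← Real.exp_add]; simp
  have h2 : 1 - Real.exp (-t) ≤ t := by linarith
  have h3 : 0 ≤ 1 - Real.exp (-t) := by
    have : Real.exp (-t) ≤ 1 := Real.exp_le_one_iff.2 (by linarith)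
    linarith
  have h4 : (1 - Real.exp (-t)) ^ 2 ≤ t ^ 2 := by gcongr
  have h5 : Real.cosh t - 1 = (1 - Real.exp (-t)) ^ 2 * Real.exp t / 2 := by
    rw [Real.cosh_eq]
    linear_combination (-1 + Real.exp (-t) / 2) * (-hp)
  rw [h5]
  gcongr

lemma sinh_le_mul_cosh {t : ℝ} (ht : 0 ≤ t) : Real.sinh t ≤ t * Real.cosh t := by
  have hmono : MonotoneOn (fun x => x * Real.cosh x - Real.sinh x) (Set.Ici 0) := by
    refine monotoneOn_of_deriv_nonneg (convex_Ici 0) (by fun_prop) (by fun_prop) ?_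
    intro x hx
    rw [interior_Ici] at hx
    have hx : 0 < x := hx
    have : HasDerivAt (fun x => x * Real.cosh x - Real.sinh x)
        (1 * Real.cosh x + x * Real.sinh x - Real.cosh x) x :=
      ((hasDerivAt_id x).mul (Real.hasDerivAt_cosh x)).sub (Real.hasDerivAt_sinh x)
    rw [this.deriv]
    have := Real.sinh_nonneg_iff.2 hx.le
    nlinarith [mul_nonneg hx.le this]
  have := hmono (Set.mem_Ici.2 le_rfl) (Set.mem_Ici.2 ht) ht
  simp at this
  linarith

/-- The main term of the integrand. -/
noncomputable def mterm (μ r θ t : ℝ) : ℂ :=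
  Complex.exp (((μ * θ - π * r / 2 : ℝ) : ℂ) * Complex.I) *
    ((Real.sin θ ^ r * (t ^ r * Real.exp (-(μ * t))) : ℝ) : ℂ)

lemma mt_eq {μ r θ t : ℝ} (hs : 0 < Real.sin θ) (ht : 0 < t) :
    mterm μ r θ t = Complex.exp (Complex.I * (μ : ℂ) * ((θ : ℂ) + (t : ℂ) * Complex.I)) *
      (((Real.sin θ * t : ℝ) : ℂ) * (-Complex.I)) ^ ((r : ℝ) : ℂ) := by
  have hst : 0 < Real.sin θ * t := by positivity
  have hne : ((Real.sin θ * t : ℝ) : ℂ) * (-Complex.I) ≠ 0 :=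
    mul_ne_zero (Complex.ofReal_ne_zero.2 hst.ne') (neg_ne_zero.2 Complex.I_ne_zero)
  rw [Complex.cpow_def_of_ne_zero hne, Complex.log_ofReal_mul hst (neg_ne_zero.2 Complex.I_ne_zero),
    Complex.log_neg_I, ← Complex.exp_add]
  have h1 : Real.sin θ ^ r * (t ^ r * Real.exp (-(μ * t))) =
      Real.exp (Real.log (Real.sin θ * t) * r + -(μ * t)) := by
    rw [Real.exp_add, ← Real.rpow_def_of_pos hst, Real.mul_rpow hs.le ht.le]; ring
  unfold mterm
  rw [h1, Complex.ofReal_exp, ← Complex.exp_add]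
  congr 1
  push_cast
  linear_combination (-(μ:ℂ) * t) * Complex.I_sq

lemma diff_bound {μ r θ t : ℝ} (h0 : 0 < θ) (h1 : θ < π) (hr : r ≤ 1) (ht : 0 < t) :
    ‖cf μ r θ ((θ:ℂ) + (t:ℂ) * Complex.I) - mterm μ r θ t‖ ≤
      |r| * Real.sin θ ^ (r - 1) * (|Real.cos θ| * (t ^ (r + 1) * Real.exp (-((μ - 1) * t))) +
        Real.sin θ * (2 / 3) * (t ^ (r + 2) * Real.exp (-((μ - 1) * t)))) := by
  have hs : 0 < Real.sin θ := Real.sin_pos_of_pos_of_lt_pi h0 h1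
  rw [mt_eq hs ht]
  have hcf : cf μ r θ ((θ:ℂ) + (t:ℂ) * Complex.I) =
      Complex.exp (Complex.I * (μ : ℂ) * ((θ : ℂ) + (t : ℂ) * Complex.I)) *
        (cw θ θ t) ^ ((r : ℝ) : ℂ) := rfl
  rw [hcf, ← mul_sub, norm_mul]
  have hE : ‖Complex.exp (Complex.I * (μ : ℂ) * ((θ : ℂ) + (t : ℂ) * Complex.I))‖ =
      Real.exp (-(μ * t)) := by
    rw [Complex.norm_exp]; congr 1; simp
  rw [hE]
  have hst : 0 < Real.sin θ * t := by positivity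
  have hsinh : t ≤ Real.sinh t := Real.self_le_sinh_iff.2 ht.le
  have hM := cpow_mvt (m := Real.sin θ * t) hst hr (w := cw θ θ t)
    (w0 := ((Real.sin θ * t : ℝ) : ℂ) * (-Complex.I))
    (by rw [cw_im]; nlinarith) (by simp [-Complex.ofReal_mul])
  have hc1 := cosh_sub_one_le ht.le
  have hc0 := Real.one_le_cosh t
  have hsh := sinh_le_mul_cosh ht.le
  have het := Real.exp_pos t
  have hd : ‖cw θ θ t - ((Real.sin θ * t : ℝ) : ℂ) * (-Complex.I)‖ ≤
      |Real.cos θ| * (t ^ 2 * Real.exp t) + Real.sin θ * (2 / 3) * (t ^ 3 * Real.exp t) := by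
    refine (Complex.norm_le_abs_re_add_abs_im _).trans ?_
    have e1 : (cw θ θ t - ((Real.sin θ * t : ℝ) : ℂ) * (-Complex.I)).re =
        Real.cos θ * (Real.cosh t - 1) := by
      rw [Complex.sub_re, cw_re]
      simp [-Complex.ofReal_mul]
      ring
    have e2 : (cw θ θ t - ((Real.sin θ * t : ℝ) : ℂ) * (-Complex.I)).im =
        -(Real.sin θ * (Real.sinh t - t)) := by
      rw [Complex.sub_im, cw_im]
      simp [-Complex.ofReal_mul]
      ring
    rw [e1, e2, abs_neg, abs_mul, abs_mul, abs_of_pos hs, abs_of_nonneg (sub_nonneg.2 hc0),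
      abs_of_nonneg (sub_nonneg.2 hsinh), mul_assoc (Real.sin θ)]
    have p2 : 0 < t ^ 2 * Real.exp t := by positivity
    have p3 : 0 < t ^ 3 * Real.exp t := by positivity
    refine add_le_add ?_ ?_
    · exact mul_le_mul_of_nonneg_left (by linarith) (abs_nonneg _)
    · refine mul_le_mul_of_nonneg_left ?_ hs.le
      have : t * (Real.cosh t - 1) ≤ t * (t ^ 2 * Real.exp t / 2) := mul_le_mul_of_nonneg_left hc1 ht.le
      nlinarith
  have hfin := mul_le_mul_of_nonneg_left (hM.trans (mul_le_mul_of_nonneg_left hd (by positivity)))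
    (Real.exp_pos (-(μ * t))).le
  refine hfin.trans (le_of_eq ?_)
  have q1 : t ^ (r + 1) = t ^ (r - 1) * t ^ 2 := by
    rw [← Real.rpow_natCast t 2, ← Real.rpow_add ht]; congr 1; push_cast; ring
  have q2 : t ^ (r + 2) = t ^ (r - 1) * t ^ 3 := by
    rw [← Real.rpow_natCast t 3, ← Real.rpow_add ht]; congr 1; push_cast; ring
  have q3 : Real.exp (-((μ - 1) * t)) = Real.exp (-(μ * t)) * Real.exp t := by
    rw [← Real.exp_add]; congr 1; ring
  rw [q1, q2, q3, Real.mul_rpow hs.le ht.le]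
  ring

lemma gam_int {a b : ℝ} (ha : 0 < a) (hb : 0 < b) :
    MeasureTheory.IntegrableOn (fun t : ℝ => t ^ (a - 1) * Real.exp (-(b * t))) (Set.Ioi 0) := by
  refine MeasureTheory.Integrable.of_integral_ne_zero ?_
  rw [Real.integral_rpow_mul_exp_neg_mul_Ioi ha hb]
  have := Real.Gamma_pos_of_pos ha
  positivity

lemma asym {μ lam θ : ℝ} (h0 : 0 < θ) (h1 : θ < π) (hl : 0 < lam) (hl2 : lam ≤ 2) (hμ : 1 < μ) :
    |(∫ φ : ℝ in Set.Ioo 0 θ, Real.cos (μ * φ) * (Real.cos φ - Real.cos θ) ^ (lam - 1)) -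
      Real.sin θ ^ (lam - 1) * ((1 / μ) ^ lam * Real.Gamma lam) * Real.cos (μ * θ - lam * π / 2)| ≤
    |lam - 1| * Real.sin θ ^ (lam - 2) *
      (|Real.cos θ| * ((1 / (μ - 1)) ^ (lam + 1) * Real.Gamma (lam + 1)) +
        Real.sin θ * (2 / 3) * ((1 / (μ - 1)) ^ (lam + 2) * Real.Gamma (lam + 2))) := by
  have hs : 0 < Real.sin θ := Real.sin_pos_of_pos_of_lt_pi h0 h1
  have hμ1 : 0 < μ - 1 := by linarith
  set C : ℂ → ℂ := cf μ (lam - 1) θ with hC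
  have I0 := gam_int hl (show 0 < μ by linarith)
  have I1 := gam_int (show 0 < lam + 1 by linarith) hμ1
  have I2 := gam_int (show 0 < lam + 2 by linarith) hμ1
  have V0 := Real.integral_rpow_mul_exp_neg_mul_Ioi hl (show 0 < μ by linarith)
  have V1 := Real.integral_rpow_mul_exp_neg_mul_Ioi (show 0 < lam + 1 by linarith) hμ1
  have V2 := Real.integral_rpow_mul_exp_neg_mul_Ioi (show 0 < lam + 2 by linarith) hμ1
  have hmt : MeasureTheory.IntegrableOn (mterm μ (lam - 1) θ) (Set.Ioi 0) := by
    unfold mterm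
    exact ((I0.const_mul _).ofReal).const_mul _
  have hmtV : ∫ t in Set.Ioi 0, mterm μ (lam - 1) θ t =
      Complex.exp (((μ * θ - π * (lam - 1) / 2 : ℝ) : ℂ) * Complex.I) *
        ((Real.sin θ ^ (lam - 1) * ((1 / μ) ^ lam * Real.Gamma lam) : ℝ) : ℂ) := by
    unfold mterm
    rw [MeasureTheory.integral_const_mul, integral_complex_ofReal,
      MeasureTheory.integral_const_mul, V0]
  have hB := ((I1.const_mul |Real.cos θ|).add (I2.const_mul (Real.sin θ * (2 / 3)))).const_mul
    (|lam - 1| * Real.sin θ ^ (lam - 2))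
  have hle : ∀ t ∈ Set.Ioi (0:ℝ), ‖C ((θ:ℂ) + (t:ℂ) * Complex.I) - mterm μ (lam - 1) θ t‖ ≤
      |lam - 1| * Real.sin θ ^ (lam - 2) *
        (|Real.cos θ| * (t ^ (lam + 1 - 1) * Real.exp (-((μ - 1) * t))) +
        Real.sin θ * (2 / 3) * (t ^ (lam + 2 - 1) * Real.exp (-((μ - 1) * t)))) := by
    intro t ht
    have := diff_bound (μ := μ) (r := lam - 1) h0 h1 (by linarith) ht
    rw [show lam - 1 - 1 = lam - 2 by ring, show lam - 1 + 1 = lam + 1 - 1 by ring,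
      show lam - 1 + 2 = lam + 2 - 1 by ring] at this
    exact this
  have hcont : ContinuousOn (fun t : ℝ => C ((θ:ℂ) + (t:ℂ) * Complex.I)) (Set.Ioi 0) := by
    intro t ht
    have ht : 0 < t := ht
    refine ContinuousAt.continuousWithinAt ?_
    refine ContinuousAt.comp (f := fun t : ℝ => ((θ:ℂ) + (t:ℂ) * Complex.I)) (g := C) ?_ (by fun_prop)
    exact (cf_diff h0 h1 (by simpa using h0.le) (by simp) (by simpa using ht)).continuousAt
  have hmeas := hcont.aestronglyMeasurable (μ := MeasureTheory.volume) measurableSet_Ioi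
  have hD : MeasureTheory.IntegrableOn
      (fun t : ℝ => C ((θ:ℂ) + (t:ℂ) * Complex.I) - mterm μ (lam - 1) θ t) (Set.Ioi 0) := by
    refine MeasureTheory.Integrable.mono' hB (hmeas.sub hmt.1) ?_
    exact (MeasureTheory.ae_restrict_iff' measurableSet_Ioi).2 (Filter.Eventually.of_forall hle)
  have hCint : MeasureTheory.IntegrableOn (fun t : ℝ => C ((θ:ℂ) + (t:ℂ) * Complex.I)) (Set.Ioi 0) := by
    have := hD.add hmt
    refine this.congr (Filter.Eventually.of_forall ?_)
    intro t
    simp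
  rw [contour h0 h1 hμ (by linarith) (by linarith) hCint]
  have hsub := MeasureTheory.integral_sub hCint hmt
  have him : (∫ t in Set.Ioi 0, mterm μ (lam - 1) θ t).im =
      Real.sin θ ^ (lam - 1) * ((1 / μ) ^ lam * Real.Gamma lam) * Real.cos (μ * θ - lam * π / 2) := by
    rw [hmtV, Complex.im_mul_ofReal, Complex.exp_ofReal_mul_I_im]
    rw [show μ * θ - π * (lam - 1) / 2 = (μ * θ - lam * π / 2) + π / 2 by ring, Real.sin_add_pi_div_two]
    ring
  rw [← him, ← Complex.sub_im]
  rw [← hsub]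
  refine (Complex.abs_im_le_norm _).trans ?_
  refine (MeasureTheory.norm_integral_le_of_norm_le hB
    ((MeasureTheory.ae_restrict_iff' measurableSet_Ioi).2 (Filter.Eventually.of_forall hle))).trans ?_
  refine le_of_eq ?_
  have hadd := MeasureTheory.integral_add (I1.const_mul |Real.cos θ|) (I2.const_mul (Real.sin θ * (2 / 3)))
  rw [MeasureTheory.integral_const_mul]
  refine congrArg _ (hadd.trans ?_)
  rw [MeasureTheory.integral_const_mul, MeasureTheory.integral_const_mul, V1, V2]

/-- Weighted uniform bound on `[0, π)` for `0 < λ ≤ 2`.  The right-hand side uses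
`|cos θ| = sin θ · |cot θ|`, which is the continuous extension of
`(sin θ) · (|cot θ| + (2/3)(λ+1)/(ν+λ−1))` to `θ = 0`. -/
theorem ggf_weighted_uniform_bound_small_lambda (lam nu : ℝ) (hlam0 : 0 < lam)
    (hlam2 : lam ≤ 2) (hnu : 0 < nu) (hsum : 1 < nu + lam)
    (θ : ℝ) (hθ : θ ∈ Set.Ico 0 π) :
    |Real.sin θ ^ (lam + 1) * rG lam nu (Real.cos θ) -
        (2 ^ lam * Real.Gamma (lam + 1 / 2)) / (Real.sqrt π * (nu + lam) ^ lam) *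
          Real.sin θ * Real.cos ((nu + lam) * θ - lam * π / 2)| ≤
      (lam * |lam - 1| * 2 ^ lam * Real.Gamma (lam + 1 / 2)) /
          (Real.sqrt π * (nu + lam - 1) ^ (lam + 1)) *
        (|Real.cos θ| + Real.sin θ * (2 / 3 * (lam + 1) / (nu + lam - 1))) := by
  have hμ1 : 0 < nu + lam - 1 := by linarith
  have hμ : 0 < nu + lam := by linarith
  have hG : 0 < Real.Gamma (lam + 1 / 2) := Real.Gamma_pos_of_pos (by linarith)
  have hGl : 0 < Real.Gamma lam := Real.Gamma_pos_of_pos hlam0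
  rcases hθ.1.eq_or_lt with h | h0
  · rw [← h, Real.sin_zero, Real.zero_rpow (by linarith)]
    simp only [zero_mul, mul_zero, sub_self, abs_zero, add_zero]
    positivity
  have h1 := hθ.2
  have hs : 0 < Real.sin θ := Real.sin_pos_of_pos_of_lt_pi h0 h1
  have key := asym h0 h1 hlam0 hlam2 hsum
  rw [mehler lam nu hlam0 hμ h0 h1] at key
  have hsp : 0 < √π := Real.sqrt_pos.2 Real.pi_pos
  have h2l : (0:ℝ) < 2 ^ lam := by positivity
  set k : ℝ := √π * Real.Gamma lam / (2 ^ lam * Real.Gamma (lam + 1/2)) with hk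
  have hkpos : 0 < k := by positivity
  set s := Real.sin θ with hsdef
  have hF : 0 < s ^ (2 - lam) / k := by positivity
  have key2 := mul_le_mul_of_nonneg_left key hF.le
  have e1 : s ^ (lam + 1) = s ^ (2 - lam) * s ^ (2 * lam - 1) := by
    rw [← Real.rpow_add hs]; congr 1; ring
  have e2 : s ^ (2 - lam) * s ^ (lam - 1) = s := by
    rw [← Real.rpow_add hs]
    rw [show 2 - lam + (lam - 1) = 1 by ring, Real.rpow_one]
  have e3 : s ^ (2 - lam) * s ^ (lam - 2) = 1 := by
    rw [← Real.rpow_add hs]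
    rw [show 2 - lam + (lam - 2) = 0 by ring, Real.rpow_zero]
  have g1 : Real.Gamma (lam + 1) = lam * Real.Gamma lam := Real.Gamma_add_one hlam0.ne'
  have g2 : Real.Gamma (lam + 2) = (lam + 1) * (lam * Real.Gamma lam) := by
    rw [show lam + 2 = lam + 1 + 1 by ring, Real.Gamma_add_one (by linarith), g1]
  have i0 : (1 / (nu + lam)) ^ lam = ((nu + lam) ^ lam)⁻¹ := by
    rw [one_div, Real.inv_rpow hμ.le]
  have i1 : (1 / (nu + lam - 1)) ^ (lam + 1) = ((nu + lam - 1) ^ (lam + 1))⁻¹ := by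
    rw [one_div, Real.inv_rpow hμ1.le]
  have i2 : (1 / (nu + lam - 1)) ^ (lam + 2) = ((nu + lam - 1) ^ (lam + 1) * (nu + lam - 1))⁻¹ := by
    rw [one_div, Real.inv_rpow hμ1.le, show lam + 2 = lam + 1 + 1 by ring, Real.rpow_add_one hμ1.ne']
  rw [← abs_of_pos hF, ← abs_mul, abs_of_pos hF, i0, i1, i2, g1, g2] at key2
  have P0 : 0 < (nu + lam) ^ lam := by positivity
  have P1 : 0 < (nu + lam - 1) ^ (lam + 1) := by positivity
  refine Eq.trans_le (congrArg _ ?_) (key2.trans_eq ?_)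
  · rw [e1]
    set A := s ^ (2 - lam)
    set B := s ^ (lam - 1)
    have : A / k * (k * (s ^ (2 * lam - 1) * rG lam nu (Real.cos θ)) -
        B * (((nu + lam) ^ lam)⁻¹ * Real.Gamma lam) * Real.cos ((nu + lam) * θ - lam * π / 2)) =
        A * s ^ (2 * lam - 1) * rG lam nu (Real.cos θ) -
        (A * B) * (((nu + lam) ^ lam)⁻¹ * (Real.Gamma lam / k)) * Real.cos ((nu + lam) * θ - lam * π / 2) := by
      field_simp
    rw [this, e2]
    rw [hk]
    field_simp
  · set A := s ^ (2 - lam)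
    set B := s ^ (lam - 2)
    set N := (nu + lam - 1) ^ (lam + 1)
    have : ∀ X : ℝ, A / k * (|lam - 1| * B * X) = |lam - 1| * (1 / k) * X := by
      intro X
      rw [show A / k * (|lam - 1| * B * X) = (A * B) * (|lam - 1| * (1 / k) * X) by ring, e3, one_mul]
    rw [this, hk]
    field_simp
end

section
/- For every real λ > 0, every real ν ≥ 0, and every φ ∈ (0,π), ∫_0^φ cos((ν+λ)ϑ) · (cos ϑ − cos φ)^{λ−1} dϑ = (Γ(λ)/(ν+λ)^λ) · (sin φ)^{λ−1} · cos((ν+λ)φ − λπ/2) + ∫_0^∞ Re( i · e^{−i(ν+λ)φ} · f^{(λ)}(φ,t) ) · t^λ · e^{−(ν+λ)t} dt. -/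
open Real MeasureTheory

/-- `g(φ,t) = (cos(φ − it) − cos φ)/t` for `t ≠ 0`, with `g(φ,0) = i sin φ`. -/
noncomputable def gfun (φ t : ℝ) : ℂ :=
  if t = 0 then Complex.I * (Real.sin φ : ℂ)
  else (Complex.cos ((φ : ℂ) - Complex.I * (t : ℂ)) - Complex.cos (φ : ℂ)) / (t : ℂ)

/-- `f^{(λ)}(φ,t) = (g(φ,t)^{λ−1} − g(φ,0)^{λ−1})/t`, complex powers with the
principal branch. -/
noncomputable def ffun (lam φ t : ℝ) : ℂ :=
  (gfun φ t ^ ((lam : ℂ) - 1) - gfun φ 0 ^ ((lam : ℂ) - 1)) / (t : ℂ)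

/-- The contour integrand. -/
noncomputable def Fz (lam mu φ : ℝ) (z : ℂ) : ℂ :=
  Complex.exp (-Complex.I * mu * z) *
    (Complex.cos z - Complex.cos (φ : ℂ)) ^ ((lam - 1 : ℝ) : ℂ)

/-- The base of the power. -/
noncomputable def Bz (φ x y : ℝ) : ℂ :=
  Complex.cos ((x : ℂ) - (y : ℂ) * Complex.I) - Complex.cos (φ : ℂ)

lemma Bz_eq (φ x y : ℝ) : Bz φ x y =
    ⟨Real.cos x * Real.cosh y - Real.cos φ, Real.sin x * Real.sinh y⟩ := by
  unfold Bz
  have h : (x : ℂ) - (y : ℂ) * Complex.I = (x : ℂ) + ((-y : ℝ) : ℂ) * Complex.I := by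
    push_cast; ring
  rw [h, Complex.cos_add_mul_I, ← Complex.ofReal_cos, ← Complex.ofReal_cosh,
    ← Complex.ofReal_sin, ← Complex.ofReal_sinh, ← Complex.ofReal_cos]
  apply Complex.ext <;>
    simp [-Complex.ofReal_cos, -Complex.ofReal_sin, -Complex.ofReal_cosh, -Complex.ofReal_sinh]

lemma Bz_re (φ x y : ℝ) : (Bz φ x y).re = Real.cos x * Real.cosh y - Real.cos φ := by
  rw [Bz_eq]

lemma Bz_im (φ x y : ℝ) : (Bz φ x y).im = Real.sin x * Real.sinh y := by
  rw [Bz_eq]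

lemma Bz_slit {φ x y : ℝ} (hφ : φ ∈ Set.Ioo 0 π) (hx : 0 ≤ x) (hx2 : x ≤ φ) (hy : 0 ≤ y)
    (hxy : x < φ ∨ 0 < y) : Bz φ x y ∈ Complex.slitPlane := by
  rw [Complex.mem_slitPlane_iff, Bz_re, Bz_im]
  obtain ⟨h0, h1⟩ := hφ
  by_cases hpos : 0 < x ∧ 0 < y
  · right
    have := Real.sin_pos_of_pos_of_lt_pi hpos.1 (by linarith)
    have := Real.sinh_pos_iff.2 hpos.2
    positivity
  · left
    rcases hx.eq_or_lt with h | h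
    · subst h
      have := Real.one_le_cosh y
      have h3 : Real.cos φ < Real.cos 0 :=
        Real.cos_lt_cos_of_nonneg_of_le_pi le_rfl h1.le h0
      rw [Real.cos_zero] at *
      linarith
    · have hy0 : y = 0 := by
        by_contra hne
        exact hpos ⟨h, lt_of_le_of_ne hy (Ne.symm hne)⟩
      subst hy0
      have hlt : x < φ := by simpa using hxy
      have h3 : Real.cos φ < Real.cos x :=
        Real.cos_lt_cos_of_nonneg_of_le_pi hx h1.le hlt
      simp; linarith

lemma Bz_norm_sq (φ x y : ℝ) : ‖Bz φ x y‖ ^ 2 = Real.cosh y ^ 2 -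
    2 * Real.cos x * Real.cos φ * Real.cosh y + Real.cos x ^ 2 + Real.cos φ ^ 2 - 1 := by
  rw [Complex.sq_norm, Complex.normSq_apply, Bz_re, Bz_im]
  have h1 := Real.sin_sq_add_cos_sq x
  have h2 := Real.cosh_sq y
  have h3 : Real.sin x ^ 2 = 1 - Real.cos x ^ 2 := by linarith
  have h4 : Real.sinh y ^ 2 = Real.cosh y ^ 2 - 1 := by linarith
  have : (Real.sin x * Real.sinh y) * (Real.sin x * Real.sinh y) =
    (1 - Real.cos x ^ 2) * (Real.cosh y ^ 2 - 1) := by rw [← h3, ← h4]; ring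
  rw [this]; ring

lemma cos_mul_cos_le (a b : ℝ) : |Real.cos a * Real.cos b| ≤ 1 := by
  rw [abs_mul]
  exact mul_le_one₀ (Real.abs_cos_le_one a) (abs_nonneg _) (Real.abs_cos_le_one b)

lemma Bz_norm_ge (φ x y : ℝ) : Real.cos x - Real.cos φ ≤ ‖Bz φ x y‖ := by
  apply le_of_abs_le
  apply abs_le_of_sq_le_sq _ (norm_nonneg _)
  rw [Bz_norm_sq]
  have h := abs_le.1 (cos_mul_cos_le x φ)
  have := Real.one_le_cosh y
  nlinarith [mul_nonneg (sub_nonneg.2 this)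
    (show 0 ≤ Real.cosh y + 1 - 2 * (Real.cos x * Real.cos φ) by linarith)]

lemma Bz_norm_le (φ x : ℝ) {y : ℝ} (hy : 0 ≤ y) : ‖Bz φ x y‖ ≤ 2 * Real.exp y := by
  have h1 : ‖Bz φ x y‖ ≤ Real.cosh y + 1 := by
    apply le_of_abs_le
    apply abs_le_of_sq_le_sq _ (by have := Real.one_le_cosh y; linarith)
    rw [Bz_norm_sq]
    have h := abs_le.1 (cos_mul_cos_le x φ)
    have := Real.one_le_cosh y
    nlinarith [Real.cos_sq_le_one x, Real.cos_sq_le_one φ]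
  have h2 : Real.cosh y ≤ Real.exp y := by
    rw [← Real.cosh_add_sinh]
    have := Real.sinh_nonneg_iff.2 hy
    linarith
  have h3 := Real.one_le_exp hy
  linarith

lemma Bz_norm_ge_vert {φ y : ℝ} (hφ : φ ∈ Set.Ioo 0 π) (hy : 0 ≤ y) :
    Real.sin φ * y ≤ ‖Bz φ φ y‖ := by
  have h := Complex.abs_im_le_norm (Bz φ φ y)
  rw [Bz_im] at h
  have h1 := Real.sin_pos_of_pos_of_lt_pi hφ.1 hφ.2
  have h2 := Real.self_le_sinh_iff.2 hy
  calc Real.sin φ * y ≤ Real.sin φ * Real.sinh y := by gcongr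
    _ ≤ _ := (le_abs_self _).trans h

lemma Bz_norm_ge_one (φ x : ℝ) {y : ℝ} (hy : 3 ≤ y) : 1 ≤ ‖Bz φ x y‖ := by
  apply le_of_abs_le
  apply abs_le_of_sq_le_sq _ (norm_nonneg _)
  rw [Bz_norm_sq]
  have h := abs_le.1 (cos_mul_cos_le x φ)
  have h2 : y ≤ Real.cosh y :=
    (Real.self_le_sinh_iff.2 (by linarith)).trans (Real.sinh_lt_cosh y).le
  nlinarith [sq_nonneg (Real.cos x), sq_nonneg (Real.cos φ)]

lemma cos_sub_ge {φ : ℝ} (hφ : φ ∈ Set.Ioo 0 π) : ∃ c > 0, ∀ x, 0 ≤ x → x ≤ φ →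
    c * (φ - x) ≤ Real.cos x - Real.cos φ := by
  obtain ⟨h0, h1⟩ := hφ
  set m := min (Real.sin (φ / 2)) (Real.sin φ)
  have hm : 0 < m := lt_min (Real.sin_pos_of_pos_of_lt_pi (by linarith) (by linarith))
    (Real.sin_pos_of_pos_of_lt_pi h0 h1)
  refine ⟨m * (2 / π), by have := Real.pi_pos; positivity, fun x hx hx2 => ?_⟩
  have e1 : Real.cos x - Real.cos φ =
      2 * (Real.sin ((x + φ) / 2) * Real.sin ((φ - x) / 2)) := by
    rw [Real.cos_sub_cos, show (x - φ) / 2 = -((φ - x) / 2) by ring, Real.sin_neg]; ring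
  have e2 : m ≤ Real.sin ((x + φ) / 2) :=
    ConcaveOn.min_le_of_mem_Icc strictConcaveOn_sin_Icc.concaveOn
      (by constructor <;> linarith) (by constructor <;> linarith)
      (by constructor <;> linarith)
  have e3 : 2 / π * ((φ - x) / 2) ≤ Real.sin ((φ - x) / 2) :=
    Real.mul_le_sin (by linarith) (by linarith)
  have e4 : 0 ≤ 2 / π * ((φ - x) / 2) := by
    have := Real.pi_pos
    have : 0 ≤ φ - x := by linarith
    positivity
  rw [e1]
  have := mul_le_mul e2 e3 e4 (hm.le.trans e2)
  linarith

lemma Fz_eq (lam mu φ x y : ℝ) : Fz lam mu φ ((x : ℂ) - (y : ℂ) * Complex.I) =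
    Complex.exp (-Complex.I * mu * ((x : ℂ) - (y : ℂ) * Complex.I)) *
      Bz φ x y ^ ((lam - 1 : ℝ) : ℂ) := rfl

lemma Fz_norm (lam mu φ x y : ℝ) : ‖Fz lam mu φ ((x : ℂ) - (y : ℂ) * Complex.I)‖ =
    Real.exp (-mu * y) * ‖Bz φ x y‖ ^ (lam - 1) := by
  rw [Fz_eq, norm_mul, Complex.norm_cpow_real, Complex.norm_exp]
  congr 2
  simp

lemma Fz_diff {φ x y : ℝ} (lam mu : ℝ) (hφ : φ ∈ Set.Ioo 0 π) (hx : 0 ≤ x) (hx2 : x ≤ φ)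
    (hy : 0 ≤ y) (hxy : x < φ ∨ 0 < y) :
    DifferentiableAt ℂ (Fz lam mu φ) ((x : ℂ) - (y : ℂ) * Complex.I) := by
  unfold Fz
  have h := Bz_slit hφ hx hx2 hy hxy
  apply DifferentiableAt.mul
  · fun_prop
  · exact DifferentiableAt.cpow_const (by fun_prop) h

/-- Horizontal bound. -/
lemma Fz_top_bound {φ : ℝ} (lam mu : ℝ) (hlam : 0 < lam) (hmu : 0 < mu)
    (hφ : φ ∈ Set.Ioo 0 π) : ∃ b : ℝ → ℝ, IntervalIntegrable b volume 0 φ ∧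
      ∀ x y : ℝ, 0 ≤ x → x < φ → 0 ≤ y → y ≤ 1 →
        ‖Fz lam mu φ ((x : ℂ) - (y : ℂ) * Complex.I)‖ ≤ b x := by
  have hexp : ∀ y : ℝ, 0 ≤ y → Real.exp (-mu * y) ≤ 1 := fun y hy => by
    rw [Real.exp_le_one_iff]; nlinarith
  by_cases h : 1 ≤ lam
  · refine ⟨fun _ => (2 * Real.exp 1) ^ (lam - 1), by simp, fun x y hx hx2 hy hy1 => ?_⟩
    rw [Fz_norm]
    calc _ ≤ 1 * (2 * Real.exp 1) ^ (lam - 1) := by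
          gcongr
          · exact hexp y hy
          · exact (Bz_norm_le φ x hy).trans (by gcongr)
      _ = _ := one_mul _
  · push Not at h
    obtain ⟨c, hc, hcx⟩ := cos_sub_ge hφ
    refine ⟨fun x => c ^ (lam - 1) * (φ - x) ^ (lam - 1), ?_, fun x y hx hx2 hy hy1 => ?_⟩
    · apply IntervalIntegrable.const_mul
      have := (intervalIntegral.intervalIntegrable_rpow' (a := 0) (b := φ) (r := lam - 1)
        (by linarith)).comp_sub_left φ (by finiteness)
      simpa using this.symm
    · beta_reduce
      rw [Fz_norm, ← Real.mul_rpow hc.le (by linarith)]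
      calc _ ≤ 1 * (c * (φ - x)) ^ (lam - 1) := by
            apply mul_le_mul (hexp y hy) _ (by positivity) zero_le_one
            apply Real.rpow_le_rpow_of_nonpos _ _ (by linarith)
            · have : 0 < φ - x := by linarith
              positivity
            · exact (hcx x hx hx2.le).trans (Bz_norm_ge φ x y)
        _ = _ := one_mul _

/-- Growth bound. -/
lemma Fz_growth {lam nu φ x y : ℝ} (h : 1 ≤ lam) (hy : 0 ≤ y) :
    ‖Fz lam (nu + lam) φ ((x : ℂ) - (y : ℂ) * Complex.I)‖ ≤
      2 ^ (lam - 1) * Real.exp (-(nu + 1) * y) := by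
  rw [Fz_norm]
  calc _ ≤ Real.exp (-(nu + lam) * y) * (2 * Real.exp y) ^ (lam - 1) := by
        gcongr
        exact Bz_norm_le φ x hy
    _ = _ := by
      rw [Real.mul_rpow (by norm_num) (by positivity), ← Real.exp_mul, mul_left_comm,
        ← Real.exp_add]
      congr 2; ring

/-- Vertical bound. -/
lemma Fz_vert_bound {φ : ℝ} (lam nu : ℝ) (hlam : 0 < lam) (hnu : 0 ≤ nu)
    (hφ : φ ∈ Set.Ioo 0 π) : ∃ b : ℝ → ℝ, IntegrableOn b (Set.Ioi 0) ∧
      ∀ t : ℝ, 0 < t → ‖Fz lam (nu + lam) φ ((φ : ℂ) - (t : ℂ) * Complex.I)‖ ≤ b t := by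
  by_cases h : 1 ≤ lam
  · exact ⟨fun t => 2 ^ (lam - 1) * Real.exp (-(nu + 1) * t),
      (exp_neg_integrableOn_Ioi 0 (by linarith)).const_mul _, fun t ht => Fz_growth h ht.le⟩
  · push Not at h
    refine ⟨fun t => Real.sin φ ^ (lam - 1) * (t ^ (lam - 1) * Real.exp (-(nu + lam) * t)),
      ?_, fun t ht => ?_⟩
    · apply Integrable.const_mul
      have := integrableOn_rpow_mul_exp_neg_mul_rpow (p := 1) (s := lam - 1) (b := nu + lam)
        (by linarith) one_pos (by linarith)
      simpa [IntegrableOn] using this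
    · have hs := Real.sin_pos_of_pos_of_lt_pi hφ.1 hφ.2
      beta_reduce
      rw [Fz_norm, ← mul_assoc, ← Real.mul_rpow hs.le ht.le, mul_comm]
      gcongr ?_ * _
      exact Real.rpow_le_rpow_of_nonpos (by positivity) (Bz_norm_ge_vert hφ ht.le) (by linarith)

/-- Bottom bound. -/
lemma Fz_bottom_tendsto {φ : ℝ} (lam nu : ℝ) (hlam : 0 < lam) (hnu : 0 ≤ nu) :
    Filter.Tendsto (fun T : ℝ => ∫ x in (0 : ℝ)..φ,
      (Fz lam (nu + lam) φ ((x : ℂ) - (T : ℂ) * Complex.I)).re) Filter.atTop (nhds 0) := by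
  obtain ⟨C, r, hr, hb⟩ : ∃ C r : ℝ, 0 < r ∧ ∀ x T : ℝ, 3 ≤ T →
      ‖Fz lam (nu + lam) φ ((x : ℂ) - (T : ℂ) * Complex.I)‖ ≤ C * Real.exp (-r * T) := by
    by_cases h : 1 ≤ lam
    · exact ⟨_, nu + 1, by linarith, fun x T hT => Fz_growth h (by linarith)⟩
    · push Not at h
      refine ⟨1, nu + lam, by linarith, fun x T hT => ?_⟩
      rw [Fz_norm, mul_comm]
      gcongr
      exact Real.rpow_le_one_of_one_le_of_nonpos (Bz_norm_ge_one φ x hT) (by linarith)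
  have hlim : Filter.Tendsto (fun T : ℝ => C * Real.exp (-r * T) * |φ - 0|) Filter.atTop
      (nhds 0) := by
    have h1 : Filter.Tendsto (fun T : ℝ => Real.exp (-r * T)) Filter.atTop (nhds 0) := by
      apply Real.tendsto_exp_atBot.comp
      exact Filter.tendsto_id.const_mul_atTop_of_neg (by linarith)
    simpa using (h1.const_mul C).mul_const |φ - 0|
  refine squeeze_zero_norm' ?_ hlim
  filter_upwards [Filter.eventually_ge_atTop 3] with T hT
  apply intervalIntegral.norm_integral_le_of_norm_le_const
  intro x _
  exact (Complex.abs_re_le_norm _).trans (hb x T hT)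

lemma Fz_cont_top {φ y : ℝ} (lam mu : ℝ) (hφ : φ ∈ Set.Ioo 0 π) (hy : 0 < y) :
    ContinuousOn (fun x : ℝ => Fz lam mu φ ((x : ℂ) - (y : ℂ) * Complex.I)) (Set.Icc 0 φ) := by
  intro x hx
  apply ContinuousAt.continuousWithinAt
  exact ContinuousAt.comp (f := fun x : ℝ => ((x : ℂ) - (y : ℂ) * Complex.I))
    (Fz_diff lam mu hφ hx.1 hx.2 hy.le (Or.inr hy)).continuousAt (by fun_prop)

lemma Fz_cont_vert {φ x : ℝ} (lam mu : ℝ) (hφ : φ ∈ Set.Ioo 0 π) (hx : x ∈ Set.Icc 0 φ) :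
    ContinuousOn (fun y : ℝ => Fz lam mu φ ((x : ℂ) - (y : ℂ) * Complex.I)) (Set.Ioi 0) := by
  intro y hy
  apply ContinuousAt.continuousWithinAt
  exact ContinuousAt.comp (f := fun y : ℝ => ((x : ℂ) - (y : ℂ) * Complex.I))
    (Fz_diff lam mu hφ hx.1 hx.2 (le_of_lt hy) (Or.inr hy)).continuousAt (by fun_prop)

lemma Fz_left_real (lam mu φ t : ℝ) (hφ : φ ∈ Set.Ioo 0 π) (ht : 0 < t) :
    Fz lam mu φ (((0 : ℝ) : ℂ) - (t : ℂ) * Complex.I) =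
      ((Real.exp (-mu * t) * (Real.cosh t - Real.cos φ) ^ (lam - 1) : ℝ) : ℂ) := by
  rw [Fz_eq, Bz_eq]
  have hpos : 0 ≤ Real.cosh t - Real.cos φ := by
    have := Real.one_le_cosh t
    have := Real.cos_le_one φ
    linarith
  rw [Complex.ofReal_mul, Complex.ofReal_cpow hpos, Complex.ofReal_exp]
  congr 2
  · push_cast
    linear_combination ((mu : ℂ) * t) * Complex.I_mul_I
  · apply Complex.ext <;> simp [-Complex.ofReal_cos]

lemma rect_identity {φ δ T : ℝ} (lam mu : ℝ) (hφ : φ ∈ Set.Ioo 0 π) (hδ : 0 < δ) (hT : δ ≤ T) :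
    (∫ x in (0 : ℝ)..φ, (Fz lam mu φ ((x : ℂ) - (δ : ℂ) * Complex.I)).re) -
      (∫ x in (0 : ℝ)..φ, (Fz lam mu φ ((x : ℂ) - (T : ℂ) * Complex.I)).re) =
    (Complex.I * ∫ t in δ..T, Fz lam mu φ ((φ : ℂ) - (t : ℂ) * Complex.I)).re := by
  have key := Complex.integral_boundary_rect_eq_zero_of_differentiableOn (Fz lam mu φ)
    (((0 : ℝ) : ℂ) - (δ : ℂ) * Complex.I) ((φ : ℂ) - (T : ℂ) * Complex.I) (by
      intro z hz
      apply DifferentiableAt.differentiableWithinAt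
      rw [Complex.mem_reProdIm] at hz
      simp only [Complex.sub_re, Complex.ofReal_re, Complex.mul_re, Complex.I_re, Complex.I_im,
        Complex.ofReal_im, Complex.sub_im, Complex.mul_im, mul_zero, mul_one, zero_mul, sub_zero,
        zero_sub, add_zero, sub_self] at hz
      rw [Set.uIcc_of_le hφ.1.le, Set.uIcc_of_ge (by linarith)] at hz
      have hz' : z = ((z.re : ℝ) : ℂ) - ((-z.im : ℝ) : ℂ) * Complex.I := by
        apply Complex.ext <;> simp
      rw [hz']
      have := hz.2.2
      exact Fz_diff lam mu hφ hz.1.1 hz.1.2 (by linarith) (Or.inr (by linarith)))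
  simp only [Complex.sub_re, Complex.ofReal_re, Complex.mul_re, Complex.I_re, Complex.I_im,
        Complex.ofReal_im, Complex.sub_im, Complex.mul_im, mul_zero, mul_one, zero_mul, sub_zero,
        zero_sub, add_zero, sub_self] at key
  have hv : ∀ x : ℝ, (∫ y in (-δ)..(-T), Fz lam mu φ ((x : ℂ) + (y : ℂ) * Complex.I)) =
      - ∫ t in δ..T, Fz lam mu φ ((x : ℂ) - (t : ℂ) * Complex.I) := by
    intro x
    rw [intervalIntegral.integral_symm, ← intervalIntegral.integral_comp_neg]
    congr 1
    apply intervalIntegral.integral_congr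
    intro t _
    simp only
    congr 1
    push_cast; ring
  have hh : ∀ s : ℝ, (∫ x in (0 : ℝ)..φ, Fz lam mu φ ((x : ℂ) + ((-s : ℝ) : ℂ) * Complex.I)) =
      ∫ x in (0 : ℝ)..φ, Fz lam mu φ ((x : ℂ) - (s : ℂ) * Complex.I) := by
    intro s
    apply intervalIntegral.integral_congr
    intro t _
    simp only
    congr 1
    push_cast; ring
  have hre : ∀ s : ℝ, 0 < s →
      (∫ x in (0 : ℝ)..φ, (Fz lam mu φ ((x : ℂ) - (s : ℂ) * Complex.I)).re) =
      (∫ x in (0 : ℝ)..φ, Fz lam mu φ ((x : ℂ) - (s : ℂ) * Complex.I)).re := by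
    intro s hs
    suffices hi : IntervalIntegrable (fun x : ℝ => Fz lam mu φ ((x : ℂ) - (s : ℂ) * Complex.I))
        volume 0 φ from
      Complex.reCLM.intervalIntegral_comp_comm hi
    apply ContinuousOn.intervalIntegrable
    rw [Set.uIcc_of_le hφ.1.le]
    exact Fz_cont_top lam mu hφ hs
  have hleft : (∫ t in δ..T, Fz lam mu φ (((0 : ℝ) : ℂ) - (t : ℂ) * Complex.I)) =
      ((∫ t in δ..T, Real.exp (-mu * t) * (Real.cosh t - Real.cos φ) ^ (lam - 1) : ℝ) : ℂ) := by
    rw [← intervalIntegral.integral_ofReal]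
    apply intervalIntegral.integral_congr
    intro t ht
    rw [Set.uIcc_of_le hT] at ht
    exact Fz_left_real lam mu φ t hφ (by linarith [ht.1])
  rw [hv, hv, hh, hh, hleft] at key
  rw [hre δ hδ, hre T (by linarith)]
  have k2 := congrArg Complex.re key
  simp only [smul_eq_mul, Complex.sub_re, Complex.add_re, Complex.mul_re, Complex.neg_re,
    Complex.neg_im, Complex.I_re, Complex.I_im, Complex.ofReal_im, Complex.zero_re] at k2
  rw [Complex.mul_re, Complex.I_re, Complex.I_im]
  linarith

lemma Fz_vert_integrable {φ : ℝ} (lam nu : ℝ) (hlam : 0 < lam) (hnu : 0 ≤ nu)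
    (hφ : φ ∈ Set.Ioo 0 π) :
    IntegrableOn (fun t : ℝ => Fz lam (nu + lam) φ ((φ : ℂ) - (t : ℂ) * Complex.I))
      (Set.Ioi 0) := by
  obtain ⟨b, hb, hle⟩ := Fz_vert_bound lam nu hlam hnu hφ
  refine Integrable.mono' hb ?_ ?_
  · exact (Fz_cont_vert lam _ hφ ⟨hφ.1.le, le_rfl⟩).aestronglyMeasurable measurableSet_Ioi
  · exact (ae_restrict_iff' measurableSet_Ioi).2 (Filter.Eventually.of_forall hle)

lemma half_strip {φ δ : ℝ} (lam nu : ℝ) (hlam : 0 < lam) (hnu : 0 ≤ nu)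
    (hφ : φ ∈ Set.Ioo 0 π) (hδ : 0 < δ) :
    (∫ x in (0 : ℝ)..φ, (Fz lam (nu + lam) φ ((x : ℂ) - (δ : ℂ) * Complex.I)).re) =
    (Complex.I * ∫ t in Set.Ioi δ,
      Fz lam (nu + lam) φ ((φ : ℂ) - (t : ℂ) * Complex.I)).re := by
  have h1 := (Fz_bottom_tendsto (φ := φ) lam nu hlam hnu).const_sub
    (∫ x in (0 : ℝ)..φ, (Fz lam (nu + lam) φ ((x : ℂ) - (δ : ℂ) * Complex.I)).re)
  rw [sub_zero] at h1
  have hint := (Fz_vert_integrable lam nu hlam hnu hφ).mono_set (Set.Ioi_subset_Ioi hδ.le)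
  have h2 := intervalIntegral_tendsto_integral_Ioi δ hint Filter.tendsto_id
  have h3 := (Complex.continuous_re.tendsto _).comp (h2.const_mul Complex.I)
  refine tendsto_nhds_unique h1 (h3.congr' ?_)
  filter_upwards [Filter.eventually_ge_atTop δ] with T hT
  exact (rect_identity lam (nu + lam) hφ hδ hT).symm

lemma quarter_strip {φ : ℝ} (lam nu : ℝ) (hlam : 0 < lam) (hnu : 0 ≤ nu)
    (hφ : φ ∈ Set.Ioo 0 π) :
    (∫ x in (0 : ℝ)..φ, (Fz lam (nu + lam) φ (x : ℂ)).re) =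
    (Complex.I * ∫ t in Set.Ioi (0 : ℝ),
      Fz lam (nu + lam) φ ((φ : ℂ) - (t : ℂ) * Complex.I)).re := by
  have hint := Fz_vert_integrable lam nu hlam hnu hφ
  have hcov : AECover (volume.restrict (Set.Ioi (0 : ℝ))) (nhdsWithin (0 : ℝ) (Set.Ioi 0))
      (fun i : ℝ => Set.Ioi i) :=
    aecover_Ioi_of_Ioi (Filter.tendsto_id.mono_left nhdsWithin_le_nhds)
  have h2 := hcov.integral_tendsto_of_countably_generated hint
  have h3 := (Complex.continuous_re.tendsto _).comp (h2.const_mul Complex.I)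
  obtain ⟨b, hb, hle⟩ := Fz_top_bound lam (nu + lam) hlam (by linarith) hφ
  have hne : ∀ᵐ x : ℝ ∂volume, x ≠ φ := by
    simp [ae_iff]
  have h1 : Filter.Tendsto (fun δ : ℝ => ∫ x in (0 : ℝ)..φ,
      (Fz lam (nu + lam) φ ((x : ℂ) - (δ : ℂ) * Complex.I)).re) (nhdsWithin (0 : ℝ) (Set.Ioi 0))
      (nhds (∫ x in (0 : ℝ)..φ, (Fz lam (nu + lam) φ (x : ℂ)).re)) := by
    apply intervalIntegral.tendsto_integral_filter_of_dominated_convergence b _ _ hb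
    · filter_upwards [hne] with x hx hx2
      rw [Set.uIoc_of_le hφ.1.le] at hx2
      have hlt : x < φ := lt_of_le_of_ne hx2.2 hx
      have hd := (Fz_diff lam (nu + lam) hφ hx2.1.le hx2.2 le_rfl (Or.inl hlt)).continuousAt
      have hc : ContinuousAt (fun δ : ℝ =>
          (Fz lam (nu + lam) φ ((x : ℂ) - (δ : ℂ) * Complex.I)).re) 0 :=
        Complex.continuous_re.continuousAt.comp
          (ContinuousAt.comp (f := fun δ : ℝ => ((x : ℂ) - (δ : ℂ) * Complex.I)) hd
            (by fun_prop))
      have := hc.tendsto.mono_left (nhdsWithin_le_nhds (s := Set.Ioi 0))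
      simpa using this
    · filter_upwards [self_mem_nhdsWithin] with δ hδ
      rw [Set.uIoc_of_le hφ.1.le]
      apply ContinuousOn.aestronglyMeasurable _ measurableSet_Ioc
      exact Complex.continuous_re.comp_continuousOn
        ((Fz_cont_top lam _ hφ hδ).mono Set.Ioc_subset_Icc_self)
    · filter_upwards [self_mem_nhdsWithin, nhdsWithin_le_nhds (Iic_mem_nhds one_pos)] with δ hδ hδ1
      filter_upwards [hne] with x hx hx2
      rw [Set.uIoc_of_le hφ.1.le] at hx2
      exact (Complex.abs_re_le_norm _).trans
        (hle x δ hx2.1.le (lt_of_le_of_ne hx2.2 hx) (le_of_lt hδ) hδ1)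
  refine tendsto_nhds_unique h1 (h3.congr' ?_)
  filter_upwards [self_mem_nhdsWithin] with δ hδ
  rw [half_strip lam nu hlam hnu hφ hδ]
  simp only [Function.comp]
  rw [Measure.restrict_restrict measurableSet_Ioi,
    Set.inter_eq_left.2 (Set.Ioi_subset_Ioi (le_of_lt hδ))]

lemma real_mul_cpow {t : ℝ} (ht : 0 < t) {g : ℂ} (hg : g ≠ 0) (a : ℝ) :
    ((t : ℂ) * g) ^ (a : ℂ) = ((t ^ a : ℝ) : ℂ) * g ^ (a : ℂ) := by
  have ht' : (t : ℂ) ≠ 0 := by exact_mod_cast ht.ne'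
  rw [Complex.ofReal_cpow ht.le, Complex.cpow_def_of_ne_zero (mul_ne_zero ht' hg),
    Complex.cpow_def_of_ne_zero ht', Complex.cpow_def_of_ne_zero hg, Complex.log_ofReal_mul ht hg,
    Complex.ofReal_log ht.le, ← Complex.exp_add]
  congr 1; ring

lemma const_eq {φ : ℝ} (lam mu : ℝ) (hφ : φ ∈ Set.Ioo 0 π) :
    (Complex.I * Complex.exp (-Complex.I * (mu : ℂ) * (φ : ℂ)) *
      gfun φ 0 ^ ((lam - 1 : ℝ) : ℂ)).re =
    Real.sin φ ^ (lam - 1) * Real.cos (mu * φ - lam * π / 2) := by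
  have hs := Real.sin_pos_of_pos_of_lt_pi hφ.1 hφ.2
  have hg : gfun φ 0 = (Real.sin φ : ℂ) * Complex.I := by simp [gfun, mul_comm]
  rw [hg, real_mul_cpow hs Complex.I_ne_zero, Complex.cpow_def_of_ne_zero Complex.I_ne_zero,
    Complex.log_I]
  have : Complex.I * Complex.exp (-Complex.I * (mu : ℂ) * (φ : ℂ)) *
      (((Real.sin φ ^ (lam - 1) : ℝ) : ℂ) *
        Complex.exp (π / 2 * Complex.I * ((lam - 1 : ℝ) : ℂ))) =
      ((Real.sin φ ^ (lam - 1) : ℝ) : ℂ) *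
        Complex.exp (((lam * π / 2 - mu * φ : ℝ) : ℂ) * Complex.I) := by
    have hI : Complex.I = Complex.exp (π / 2 * Complex.I) := by
      rw [Complex.exp_pi_div_two_mul_I]
    have e : Complex.exp (((lam * π / 2 - mu * φ : ℝ) : ℂ) * Complex.I) =
        Complex.I * Complex.exp (-Complex.I * (mu : ℂ) * (φ : ℂ)) *
          Complex.exp (π / 2 * Complex.I * ((lam - 1 : ℝ) : ℂ)) := by
      conv_rhs => rw [show ∀ a b : ℂ, Complex.I * a * b = Complex.exp (π / 2 * Complex.I) * a * b
        from fun a b => by rw [← hI]]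
      rw [← Complex.exp_add, ← Complex.exp_add]
      congr 1
      push_cast; ring
    rw [e]; ring
  rw [this, Complex.re_ofReal_mul, Complex.exp_ofReal_mul_I_re, ← Real.cos_neg]
  congr 2; ring

lemma vert_pointwise {φ t : ℝ} (lam nu : ℝ) (hφ : φ ∈ Set.Ioo 0 π) (ht : 0 < t) :
    (Complex.I * Fz lam (nu + lam) φ ((φ : ℂ) - (t : ℂ) * Complex.I)).re =
      Real.sin φ ^ (lam - 1) * Real.cos ((nu + lam) * φ - lam * π / 2) *
        (t ^ (lam - 1) * Real.exp (-((nu + lam) * t))) +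
      (Complex.I * Complex.exp (-Complex.I * ((nu : ℂ) + lam) * (φ : ℂ)) *
            ffun lam φ t).re * t ^ lam * Real.exp (-(nu + lam) * t) := by
  have ht' : (t : ℂ) ≠ 0 := by exact_mod_cast ht.ne'
  have hB : Bz φ φ t = (t : ℂ) * gfun φ t := by
    rw [gfun, if_neg ht.ne', Bz, mul_div_cancel₀ _ ht', mul_comm Complex.I]
  have hB0 := Complex.slitPlane_ne_zero (Bz_slit hφ hφ.1.le le_rfl ht.le (Or.inr ht))
  have hg : gfun φ t ≠ 0 := by
    intro h; rw [hB, h, mul_zero] at hB0; exact hB0 rfl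
  have hcast : ((nu : ℂ) + lam) = ((nu + lam : ℝ) : ℂ) := by push_cast; rfl
  have hcast2 : ((lam : ℂ) - 1) = ((lam - 1 : ℝ) : ℂ) := by push_cast; rfl
  rw [← const_eq lam (nu + lam) hφ, Fz_eq, hB, real_mul_cpow ht hg, ffun, hcast, hcast2]
  have hexp : Complex.exp (-Complex.I * ((nu + lam : ℝ) : ℂ) * ((φ : ℂ) - t * Complex.I)) =
      Complex.exp (-Complex.I * ((nu + lam : ℝ) : ℂ) * φ) *
        ((Real.exp (-((nu + lam) * t)) : ℝ) : ℂ) := by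
    rw [Complex.ofReal_exp, ← Complex.exp_add]
    congr 1
    push_cast
    linear_combination (((nu : ℂ) + lam) * t) * Complex.I_mul_I
  rw [hexp]
  have htl : t ^ lam = t ^ (lam - 1) * t := by
    rw [Real.rpow_sub_one ht.ne']; field_simp
  rw [htl, neg_mul (nu + lam) t]
  generalize Complex.exp (-Complex.I * ((nu + lam : ℝ) : ℂ) * φ) = E
  generalize gfun φ t ^ ((lam - 1 : ℝ) : ℂ) = X
  generalize gfun φ 0 ^ ((lam - 1 : ℝ) : ℂ) = Y
  generalize Real.exp (-((nu + lam) * t)) = e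
  generalize t ^ (lam - 1) = p
  have : Complex.I * (E * (e : ℂ) * ((p : ℂ) * X)) =
      Complex.I * E * Y * ((p * e : ℝ) : ℂ) +
      Complex.I * E * ((X - Y) / t) * ((p * t * e : ℝ) : ℂ) := by
    push_cast
    field_simp
    ring
  rw [this, Complex.add_re, Complex.re_mul_ofReal, Complex.re_mul_ofReal]
  ring

theorem integral_identity_residual (lam nu : ℝ) (hlam : 0 < lam) (hnu : 0 ≤ nu)
    (φ : ℝ) (hφ : φ ∈ Set.Ioo 0 π) :
    ∫ ϑ in (0 : ℝ)..φ,
        Real.cos ((nu + lam) * ϑ) * (Real.cos ϑ - Real.cos φ) ^ (lam - 1) =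
      Real.Gamma lam / (nu + lam) ^ lam * Real.sin φ ^ (lam - 1) *
          Real.cos ((nu + lam) * φ - lam * π / 2) +
        ∫ t in Set.Ioi (0 : ℝ),
          (Complex.I * Complex.exp (-Complex.I * ((nu : ℂ) + lam) * (φ : ℂ)) *
            ffun lam φ t).re * t ^ lam * Real.exp (-(nu + lam) * t) := by
  have hmu : 0 < nu + lam := by linarith
  have hL : ∫ ϑ in (0 : ℝ)..φ,
        Real.cos ((nu + lam) * ϑ) * (Real.cos ϑ - Real.cos φ) ^ (lam - 1) =
      ∫ x in (0 : ℝ)..φ, (Fz lam (nu + lam) φ (x : ℂ)).re := by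
    apply intervalIntegral.integral_congr
    intro x hx
    rw [Set.uIcc_of_le hφ.1.le] at hx
    have hpos : 0 ≤ Real.cos x - Real.cos φ :=
      sub_nonneg.2 (Real.cos_le_cos_of_nonneg_of_le_pi hx.1 hφ.2.le hx.2)
    simp only [Fz]
    rw [← Complex.ofReal_cos, ← Complex.ofReal_cos, ← Complex.ofReal_sub,
      ← Complex.ofReal_cpow hpos, Complex.re_mul_ofReal,
      show -Complex.I * ((nu + lam : ℝ) : ℂ) * (x : ℂ) =
        ((-((nu + lam) * x) : ℝ) : ℂ) * Complex.I by push_cast; ring,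
      Complex.exp_ofReal_mul_I_re, Real.cos_neg]
  have hint := Fz_vert_integrable lam nu hlam hnu hφ
  have hintI := hint.const_mul Complex.I
  have hre : (Complex.I * ∫ t in Set.Ioi (0 : ℝ),
      Fz lam (nu + lam) φ ((φ : ℂ) - (t : ℂ) * Complex.I)).re =
      ∫ t in Set.Ioi (0 : ℝ),
        (Complex.I * Fz lam (nu + lam) φ ((φ : ℂ) - (t : ℂ) * Complex.I)).re := by
    rw [← integral_const_mul]
    exact (Complex.reCLM.integral_comp_comm hintI).symm
  have hGint : IntegrableOn (fun t : ℝ => Real.sin φ ^ (lam - 1) *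
      Real.cos ((nu + lam) * φ - lam * π / 2) *
        (t ^ (lam - 1) * Real.exp (-((nu + lam) * t)))) (Set.Ioi 0) := by
    apply Integrable.const_mul
    have := integrableOn_rpow_mul_exp_neg_mul_rpow (p := 1) (s := lam - 1) (b := nu + lam)
        (by linarith) one_pos hmu
    simpa only [IntegrableOn, Real.rpow_one, neg_mul] using this
  have hreint : IntegrableOn (fun t : ℝ =>
      (Complex.I * Fz lam (nu + lam) φ ((φ : ℂ) - (t : ℂ) * Complex.I)).re) (Set.Ioi 0) :=
    Complex.reCLM.integrable_comp hintI
  rw [hL, quarter_strip lam nu hlam hnu hφ, hre]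
  have hR : (∫ t in Set.Ioi (0 : ℝ),
          (Complex.I * Complex.exp (-Complex.I * ((nu : ℂ) + lam) * (φ : ℂ)) *
            ffun lam φ t).re * t ^ lam * Real.exp (-(nu + lam) * t)) =
      ∫ t in Set.Ioi (0 : ℝ),
        ((Complex.I * Fz lam (nu + lam) φ ((φ : ℂ) - (t : ℂ) * Complex.I)).re -
        Real.sin φ ^ (lam - 1) * Real.cos ((nu + lam) * φ - lam * π / 2) *
        (t ^ (lam - 1) * Real.exp (-((nu + lam) * t)))) := by
    apply setIntegral_congr_fun measurableSet_Ioi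
    intro t ht
    simp only
    rw [vert_pointwise lam nu hφ ht]
    ring
  rw [hR, integral_sub hreint hGint, integral_const_mul,
    Real.integral_rpow_mul_exp_neg_mul_Ioi hlam hmu, Real.div_rpow zero_le_one hmu.le,
    Real.one_rpow]
  ring
end
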